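/- arXiv:2011.09691 — 5 statements merged into one kernel-verified Lean document; each statement's English description precedes it below -/
import Mathlib

section
/- For every complex number s with Re s > 1/2 and every nonnegative integer m, one has ∑_{k=0}^{m} ((-s)^k / k!) · ζ^{(k)}(s) = (s/(s-1))^{m+1} + ∑_{n=0}^{∞} C(n+m, m) · ℓ_n^{(m)} · ((1-s)/s)^n, where ζ^{(k)} denotes the k-th derivative of the Riemann zeta function (with ζ^{(0)} = ζ), and the infinite series converges. (At s = 1 the identity is understood as the limiting value.) -/
open Filter Finset MeasureTheory

/-- The Stieltjes constants `γ_n`. -/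
noncomputable def stieltjes (n : ℕ) : ℝ :=
  limUnder atTop (fun N : ℕ =>
    (∑ k ∈ Finset.range N, Real.log ((k : ℝ) + 1) ^ n / ((k : ℝ) + 1)) -
      Real.log (N : ℝ) ^ (n + 1) / ((n : ℝ) + 1))
/-- The coefficients `ℓ_n^{(m)} = -δ_{n,0} + ∑_{k=0}^n C(n,k) (-1)^{n-k} ∑_{j=0}^{m+k} γ_j/j!`. -/
noncomputable def ellGen (n m : ℕ) : ℝ :=
  -(if n = 0 then (1 : ℝ) else 0) + ∑ k ∈ Finset.range (n + 1),
    (n.choose k : ℝ) * (-1 : ℝ) ^ (n - k) *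
      ∑ j ∈ Finset.range (m + k + 1), stieltjes j / (Nat.factorial j : ℝ)

/-- Leibniz rule for the product of a smooth function with the linear factor `z - c`. -/
lemma iteratedDeriv_succ_sub_const_mul {g : ℂ → ℂ} {z : ℂ} (c : ℂ) (n : ℕ)
    (hg : ContDiffAt ℂ (n + 1 : ℕ) g z) :
    iteratedDeriv (n + 1) (fun w => (w - c) * g w) z =
      (z - c) * iteratedDeriv (n + 1) g z + (n + 1) * iteratedDeriv n g z := by
  have hzero : ∀ i : ℕ, iteratedDeriv (i + 2) (fun w : ℂ => w - c) z = 0 := by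
    intro i
    have h : deriv (fun w : ℂ => w - c) = fun _ => 1 := by
      funext w
      simp
    rw [iteratedDeriv_succ', h, iteratedDeriv_const]
    simp
  rw [iteratedDeriv_fun_mul (by fun_prop) hg, Finset.sum_range_succ', Finset.sum_range_succ']
  simp [hzero, iteratedDeriv_one, iteratedDeriv_zero]
  ring

/-- Derivative in `y` of `y ^ (-c)`, written as an exponential. -/
lemma hasDerivAt_cexp_neg_log_mul (c : ℂ) {y : ℝ} (hy : y ≠ 0) :
    HasDerivAt (fun y : ℝ => Complex.exp (-(Real.log y : ℂ) * c))
      (-(c / y) * Complex.exp (-(Real.log y : ℂ) * c)) y := by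
  have h := (((Real.hasDerivAt_log hy).ofReal_comp.fun_neg).mul_const c).cexp
  convert h using 1
  rw [Complex.ofReal_inv]
  ring

/-- The partial sums `(s - 1) ∑_{1 ≤ k ≤ N + 1} k^{-s} + (N + 1)^{1 - s}`, which approximate
`(s - 1) ζ(s)`. -/
noncomputable def zetaApprox (N : ℕ) (s : ℂ) : ℂ :=
  (s - 1) * ∑ k ∈ range (N + 1), Complex.exp (-(Real.log ((k : ℝ) + 1) : ℂ) * s) +
    Complex.exp (-(Real.log ((N : ℝ) + 1) : ℂ) * (s - 1))

lemma zetaApprox_zero (s : ℂ) : zetaApprox 0 s = s := by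
  simp [zetaApprox]

lemma differentiable_zetaApprox (N : ℕ) : Differentiable ℂ (zetaApprox N) := by
  unfold zetaApprox
  fun_prop

lemma norm_cexp_neg_log_mul_le {s : ℂ} (hs : 1 / 2 < s.re) {a y : ℝ} (ha : 1 ≤ a) (hy : a ≤ y) :
    ‖Complex.exp (-(Real.log y : ℂ) * s)‖ ≤ a ^ (-(1 / 2) : ℝ) := by
  rw [Complex.norm_exp, Real.rpow_def_of_pos (by linarith)]
  apply Real.exp_le_exp.mpr
  have h1 : Real.log a ≤ Real.log y := Real.log_le_log (by linarith) hy
  have h2 : 0 ≤ Real.log a := Real.log_nonneg ha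
  have h3 : (-(Real.log y : ℂ) * s).re = -(Real.log y * s.re) := by
    simp [Complex.mul_re]
  rw [h3]
  nlinarith

lemma norm_zetaApprox_succ_sub_le (N : ℕ) {s : ℂ} (hs : 1 / 2 < s.re) :
    ‖zetaApprox (N + 1) s - zetaApprox N s‖ ≤
      ‖s - 1‖ * (‖s‖ * ((N : ℝ) + 1) ^ (-(3 / 2) : ℝ)) := by
  set a : ℝ := (N : ℝ) + 1 with ha
  have ha1 : 1 ≤ a := by simp [ha]
  have ha0 : 0 < a := by linarith
  have hinner : ∀ x ∈ Set.Icc a (a + 1),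
      ‖Complex.exp (-(Real.log (a + 1) : ℂ) * s) - Complex.exp (-(Real.log x : ℂ) * s)‖ ≤
        ‖s‖ * a ^ (-(3 / 2) : ℝ) := by
    intro x hx
    have h := norm_image_sub_le_of_norm_deriv_le_segment' (a := x) (b := a + 1)
      (f := fun y : ℝ => Complex.exp (-(Real.log y : ℂ) * s)) (C := ‖s‖ * a ^ (-(3 / 2) : ℝ))
      (fun y hy => (hasDerivAt_cexp_neg_log_mul s
        (by linarith [hx.1, hy.1] : y ≠ 0)).hasDerivWithinAt)
      (fun y hy => ?_) (a + 1) ⟨hx.2, le_rfl⟩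
    · refine h.trans ?_
      have : 0 ≤ ‖s‖ * a ^ (-(3 / 2) : ℝ) := by positivity
      nlinarith [hx.1, hx.2]
    · have hay : a ≤ y := hx.1.trans hy.1
      have hy0 : 0 < y := by linarith
      rw [norm_mul, norm_neg, norm_div, Complex.norm_real, Real.norm_of_nonneg hy0.le]
      have h1 := norm_cexp_neg_log_mul_le hs ha1 hay
      have h2 : a ^ (-(3 / 2) : ℝ) = a⁻¹ * a ^ (-(1 / 2) : ℝ) := by
        rw [← Real.rpow_neg_one, ← Real.rpow_add ha0]
        norm_num
      rw [h2, div_eq_mul_inv, mul_assoc]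
      gcongr
  have h := norm_image_sub_le_of_norm_deriv_le_segment' (a := a) (b := a + 1)
    (f := fun y : ℝ => (s - 1) * Complex.exp (-(Real.log (a + 1) : ℂ) * s) * (y : ℂ) +
      Complex.exp (-(Real.log y : ℂ) * (s - 1)))
    (f' := fun y : ℝ => (s - 1) * (Complex.exp (-(Real.log (a + 1) : ℂ) * s) -
      Complex.exp (-(Real.log y : ℂ) * s)))
    (C := ‖s - 1‖ * (‖s‖ * a ^ (-(3 / 2) : ℝ))) (fun y hy => ?_) (fun y hy => ?_)
    (a + 1) ⟨by linarith, le_rfl⟩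
  · rw [add_sub_cancel_left, mul_one] at h
    refine le_trans (le_of_eq ?_) h
    congr 1
    have hc : ((N + 1 : ℕ) : ℝ) + 1 = a + 1 := by push_cast; rw [ha]
    simp only [zetaApprox]
    rw [Finset.sum_range_succ _ (N + 1), hc, ← ha]
    push_cast
    ring
  · have hy0 : y ≠ 0 := by linarith [hy.1]
    have hyc : (y : ℂ) ≠ 0 := by exact_mod_cast hy0
    have h1 := ((Complex.ofRealCLM.hasDerivAt (x := y)).const_mul
      ((s - 1) * Complex.exp (-(Real.log (a + 1) : ℂ) * s))).add
      (hasDerivAt_cexp_neg_log_mul (s - 1) hy0)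
    refine (HasDerivAt.congr_deriv h1 ?_).hasDerivWithinAt
    have h2 : Complex.exp (-(Real.log y : ℂ) * (s - 1)) =
        y * Complex.exp (-(Real.log y : ℂ) * s) := by
      have h3 : (y : ℂ) = Complex.exp (Real.log y : ℂ) := by
        rw [← Complex.ofReal_exp, Real.exp_log (by linarith [hy.1])]
      conv_rhs => rw [h3]
      rw [← Complex.exp_add]
      congr 1
      ring
    rw [h2]
    simp only [Complex.ofRealCLM_apply, Complex.ofReal_one]
    field_simp
    ring
  · rw [norm_mul]
    gcongr
    exact hinner y ⟨hy.1, hy.2.le⟩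

lemma tendsto_zetaApprox_of_one_lt_re {s : ℂ} (hs : 1 < s.re) :
    Tendsto (fun N => zetaApprox N s) atTop (nhds (riemannZeta₁ s)) := by
  have hs1 : s ≠ 1 := by
    rintro rfl
    simp at hs
  have hval : riemannZeta₁ s = (s - 1) * riemannZeta s + 0 := by
    rw [riemannZeta_eq_inv_sub_mul hs1, mul_inv_cancel_left₀ (sub_ne_zero.mpr hs1), add_zero]
  rw [hval]
  refine Tendsto.add (Tendsto.const_mul _ ?_) ?_
  · have hterm : ∀ k : ℕ, Complex.exp (-(Real.log ((k : ℝ) + 1) : ℂ) * s) =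
        1 / ((k : ℂ) + 1) ^ s := by
      intro k
      have hk : ((k : ℂ) + 1) ≠ 0 := by exact_mod_cast Nat.succ_ne_zero k
      rw [Complex.cpow_def_of_ne_zero hk, one_div, ← Complex.exp_neg, Complex.ofReal_log (by positivity)]
      push_cast
      ring_nf
    simp_rw [hterm]
    rw [zeta_eq_tsum_one_div_nat_add_one_cpow hs]
    have hsum : Summable fun k : ℕ => 1 / ((k : ℂ) + 1) ^ s := by
      have := (summable_nat_add_iff 1).mpr (Complex.summable_one_div_nat_cpow.mpr hs)
      simpa using this
    exact hsum.hasSum.tendsto_sum_nat.comp (tendsto_add_atTop_nat 1)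
  · rw [tendsto_zero_iff_norm_tendsto_zero]
    have hnorm : ∀ N : ℕ, ‖Complex.exp (-(Real.log ((N : ℝ) + 1) : ℂ) * (s - 1))‖ =
        Real.exp (-(Real.log ((N : ℝ) + 1) * (s.re - 1))) := by
      intro N
      rw [Complex.norm_exp]
      congr 1
      simp [Complex.mul_re]
    simp_rw [hnorm]
    refine Real.tendsto_exp_neg_atTop_nhds_zero.comp ?_
    refine Tendsto.atTop_mul_const (by linarith) ?_
    exact Real.tendsto_log_atTop.comp
      (tendsto_atTop_add_const_right _ _ tendsto_natCast_atTop_atTop)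

/-- `zetaApprox` converges to `(s - 1) ζ(s)` uniformly on the unit disc centred at `3 / 2`. -/
lemma tendstoUniformlyOn_zetaApprox :
    TendstoUniformlyOn zetaApprox riemannZeta₁ atTop (Metric.ball (3 / 2 : ℂ) 1) := by
  set U := Metric.ball (3 / 2 : ℂ) 1 with hU
  have hre : ∀ s ∈ U, 1 / 2 < s.re := by
    intro s hs
    have h1 := (Complex.abs_re_le_norm (s - 3 / 2)).trans_lt (mem_ball_iff_norm.mp hs)
    have h2 := (abs_lt.mp h1).1
    have h3 : (s - 3 / 2).re = s.re - 3 / 2 := by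
      rw [Complex.sub_re]
      norm_num
    linarith
  have hnorm : ∀ s ∈ U, ‖s‖ ≤ 3 ∧ ‖s - 1‖ ≤ 2 := by
    intro s hs
    have h1 := mem_ball_iff_norm.mp hs
    constructor
    · calc ‖s‖ = ‖(s - 3 / 2) + 3 / 2‖ := by ring_nf
        _ ≤ ‖s - 3 / 2‖ + ‖(3 / 2 : ℂ)‖ := norm_add_le _ _
        _ ≤ 3 := by norm_num; linarith
    · calc ‖s - 1‖ = ‖(s - 3 / 2) + 1 / 2‖ := by ring_nf
        _ ≤ ‖s - 3 / 2‖ + ‖(1 / 2 : ℂ)‖ := norm_add_le _ _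
        _ ≤ 2 := by norm_num; linarith
  let u : ℕ → ℝ := fun N => 2 * (3 * ((N : ℝ) + 1) ^ (-(3 / 2) : ℝ))
  have hu : Summable u := by
    have h := (summable_nat_add_iff 1).mpr
      (Real.summable_nat_rpow.mpr (by norm_num : (-(3 / 2) : ℝ) < -1))
    simp only [Nat.cast_add, Nat.cast_one] at h
    exact (h.mul_left 3).mul_left 2
  have hunif := tendstoUniformlyOn_tsum_nat hu (s := U)
    (f := fun N s => zetaApprox (N + 1) s - zetaApprox N s) (fun N s hs => by
      refine (norm_zetaApprox_succ_sub_le N (hre s hs)).trans ?_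
      have := hnorm s hs
      dsimp only [u]
      gcongr
      exacts [this.2, this.1])
  have htel : (fun N s => ∑ k ∈ range N, (zetaApprox (k + 1) s - zetaApprox k s)) =
      fun N s => zetaApprox N s - s := by
    funext N s
    rw [Finset.sum_range_sub (fun N => zetaApprox N s), zetaApprox_zero]
  rw [htel] at hunif
  set T : ℂ → ℂ := fun s => ∑' N : ℕ, (zetaApprox (N + 1) s - zetaApprox N s) with hT
  have hunif' : TendstoUniformlyOn zetaApprox (fun s => T s + s) atTop U := by
    rw [Metric.tendstoUniformlyOn_iff] at hunif ⊢
    intro ε hε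
    filter_upwards [hunif ε hε] with N hN s hs
    have := hN s hs
    rw [dist_eq_norm] at this ⊢
    convert this using 2
    ring
  have hdiff : DifferentiableOn ℂ (fun s => T s + s) U :=
    hunif'.tendstoLocallyUniformlyOn.differentiableOn
      (Eventually.of_forall fun N => (differentiable_zetaApprox N).differentiableOn)
      Metric.isOpen_ball
  have hUp : IsPreconnected U := (convex_ball _ _).isPreconnected
  have hev : (fun s => T s + s) =ᶠ[nhds (3 / 2 : ℂ)] riemannZeta₁ := by
    have h1 : ∀ᶠ s : ℂ in nhds (3 / 2), 1 < s.re :=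
      (isOpen_lt continuous_const Complex.continuous_re).mem_nhds (by
        show (1 : ℝ) < (3 / 2 : ℂ).re
        norm_num)
    filter_upwards [h1, Metric.ball_mem_nhds (3 / 2 : ℂ) one_pos] with s hs hsU
    exact tendsto_nhds_unique (hunif'.tendsto_at hsU) (tendsto_zetaApprox_of_one_lt_re hs)
  have heq : Set.EqOn (fun s => T s + s) riemannZeta₁ U :=
    (hdiff.analyticOnNhd Metric.isOpen_ball).eqOn_of_preconnected_of_eventuallyEq
      (differentiable_riemannZeta₁.differentiableOn.analyticOnNhd Metric.isOpen_ball) hUp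
      (Metric.mem_ball_self one_pos) hev
  exact hunif'.congr_right heq

/-- Locally uniform convergence of holomorphic functions passes to iterated derivatives. -/
lemma TendstoLocallyUniformlyOn.tendsto_iteratedDeriv {F : ℕ → ℂ → ℂ} {f : ℂ → ℂ} {U : Set ℂ}
    (hU : IsOpen U) (n : ℕ) (hf : TendstoLocallyUniformlyOn F f atTop U)
    (hF : ∀ N, DifferentiableOn ℂ (F N) U) {z : ℂ} (hz : z ∈ U) :
    Tendsto (fun N => iteratedDeriv n (F N) z) atTop (nhds (iteratedDeriv n f z)) := by
  induction n generalizing F f with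
  | zero => simpa using hf.tendsto_at hz
  | succ n ih =>
    simp_rw [iteratedDeriv_succ']
    exact ih (hf.deriv (Eventually.of_forall hF) hU) fun N => (hF N).deriv hU

lemma iteratedDeriv_zetaApprox (N n : ℕ) :
    iteratedDeriv (n + 1) (zetaApprox N) 1 = (-1) ^ n * (n + 1) *
      (((∑ k ∈ range (N + 1), Real.log ((k : ℝ) + 1) ^ n / ((k : ℝ) + 1)) -
        Real.log ((N + 1 : ℕ) : ℝ) ^ (n + 1) / ((n : ℝ) + 1) : ℝ) : ℂ) := by
  unfold zetaApprox
  have hg : ∀ n : ℕ, ContDiffAt ℂ n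
      (fun s : ℂ => ∑ k ∈ range (N + 1), Complex.exp (-(Real.log ((k : ℝ) + 1) : ℂ) * s)) 1 := by
    intro n
    fun_prop
  rw [iteratedDeriv_fun_add ((by fun_prop : ContDiffAt ℂ (n + 1 : ℕ) (fun s : ℂ => s - 1) 1).mul
    (hg (n + 1))) (by fun_prop), iteratedDeriv_succ_sub_const_mul 1 n (hg _),
    sub_self, zero_mul, zero_add, iteratedDeriv_fun_sum (fun i _ => by fun_prop),
    iteratedDeriv_comp_sub_const (n + 1)
      (fun z : ℂ => Complex.exp (-(Real.log ((N : ℝ) + 1) : ℂ) * z)) 1]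
  simp_rw [iteratedDeriv_cexp_const_mul]
  have hexp : ∀ k : ℕ, Complex.exp (-(Real.log ((k : ℝ) + 1) : ℂ) * 1) = ((k : ℂ) + 1)⁻¹ := by
    intro k
    rw [mul_one, ← Complex.ofReal_neg, ← Complex.ofReal_exp, Real.exp_neg,
      Real.exp_log (by positivity)]
    push_cast
    rfl
  have hn : (n : ℂ) + 1 ≠ 0 := by exact_mod_cast Nat.succ_ne_zero n
  simp_rw [hexp]
  push_cast
  simp only [sub_self, mul_zero, Complex.exp_zero, mul_one, mul_sub, Finset.mul_sum]
  rw [sub_eq_add_neg]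
  congr 1
  · refine Finset.sum_congr rfl fun k _ => ?_
    rw [neg_pow]
    ring
  · rw [neg_pow]
    field_simp
    ring

/-- The Stieltjes constants are the Laurent coefficients of `ζ` at `1`. -/
lemma iteratedDeriv_riemannZeta₀_one (n : ℕ) :
    iteratedDeriv n riemannZeta₀ 1 = (-1) ^ n * (stieltjes n : ℂ) := by
  have hmem : (1 : ℂ) ∈ Metric.ball (3 / 2 : ℂ) 1 := by
    rw [mem_ball_iff_norm]
    norm_num
  have hlim := TendstoLocallyUniformlyOn.tendsto_iteratedDeriv Metric.isOpen_ball (n + 1)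
    tendstoUniformlyOn_zetaApprox.tendstoLocallyUniformlyOn
    (fun N => (differentiable_zetaApprox N).differentiableOn) hmem
  have hderiv : iteratedDeriv (n + 1) riemannZeta₁ 1 =
      (n + 1) * iteratedDeriv n riemannZeta₀ 1 := by
    have h0 : ∀ k : ℕ, ContDiffAt ℂ k riemannZeta₀ 1 := fun k =>
      differentiable_riemannZeta₀.contDiff.contDiffAt
    have h1 : riemannZeta₁ = fun s => 1 + (s - 1) * riemannZeta₀ s := rfl
    rw [h1, iteratedDeriv_fun_add contDiffAt_const
      ((by fun_prop : ContDiffAt ℂ (n + 1 : ℕ) (fun s : ℂ => s - 1) 1).mul (h0 _)),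
      iteratedDeriv_succ_sub_const_mul 1 n (h0 _), iteratedDeriv_const]
    simp
  rw [hderiv] at hlim
  simp_rw [iteratedDeriv_zetaApprox] at hlim
  have hn : (n : ℂ) + 1 ≠ 0 := by exact_mod_cast Nat.succ_ne_zero n
  have hsq : ((-1 : ℂ) ^ n) * (-1) ^ n = 1 := by
    rw [← mul_pow]
    simp
  have hlim' := hlim.const_mul ((-1 : ℂ) ^ n * ((n : ℂ) + 1)⁻¹)
  have hcancel : ∀ x : ℂ, (-1 : ℂ) ^ n * ((n : ℂ) + 1)⁻¹ * ((-1) ^ n * (n + 1) * x) = x := by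
    intro x
    field_simp
    linear_combination x * hsq
  have hcancel' : ∀ x : ℂ, (-1 : ℂ) ^ n * ((n : ℂ) + 1)⁻¹ * ((n + 1) * x) = (-1) ^ n * x := by
    intro x
    field_simp
  simp_rw [hcancel, hcancel'] at hlim'
  have hreal := (Complex.continuous_re.tendsto _).comp hlim'
  have hst : stieltjes n = ((-1) ^ n * iteratedDeriv n riemannZeta₀ 1).re := by
    unfold stieltjes
    refine Tendsto.limUnder_eq ?_
    rw [← tendsto_add_atTop_iff_nat 1]
    exact hreal
  simp only [Function.comp_def, Complex.ofReal_re] at hreal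
  have huniq := tendsto_nhds_unique hlim' ((Complex.continuous_ofReal.tendsto _).comp hreal)
  rw [hst]
  linear_combination (-(iteratedDeriv n riemannZeta₀ 1)) * hsq + (-1) ^ n * huniq

/-- The degree `m` Taylor polynomial of `f` at `s`, evaluated at `0`. -/
noncomputable def taylorAtZero (f : ℂ → ℂ) (m : ℕ) (s : ℂ) : ℂ :=
  ∑ k ∈ range (m + 1), (-s) ^ k / (Nat.factorial k : ℂ) * iteratedDeriv k f s

lemma differentiable_iteratedDeriv {f : ℂ → ℂ} (hf : Differentiable ℂ f) (k : ℕ) :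
    Differentiable ℂ (iteratedDeriv k f) :=
  (hf.contDiff (n := (k + 1 : ℕ))).differentiable_iteratedDeriv k (by exact_mod_cast k.lt_succ_self)

lemma differentiable_taylorAtZero {f : ℂ → ℂ} (hf : Differentiable ℂ f) (m : ℕ) :
    Differentiable ℂ (taylorAtZero f m) := by
  unfold taylorAtZero
  have := differentiable_iteratedDeriv hf
  fun_prop

lemma taylorAtZero_succ (f : ℂ → ℂ) (m : ℕ) (s : ℂ) :
    taylorAtZero f (m + 1) s = taylorAtZero f m s +
      (-s) ^ (m + 1) / (Nat.factorial (m + 1) : ℂ) * iteratedDeriv (m + 1) f s := by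
  rw [taylorAtZero, Finset.sum_range_succ, taylorAtZero]

lemma hasDerivAt_taylorAtZero {f : ℂ → ℂ} (hf : Differentiable ℂ f) (m : ℕ) (s : ℂ) :
    HasDerivAt (taylorAtZero f m)
      ((-s) ^ m / (Nat.factorial m : ℂ) * iteratedDeriv (m + 1) f s) s := by
  induction m with
  | zero =>
    have h : taylorAtZero f 0 = f := by
      funext z
      simp [taylorAtZero]
    rw [h]
    simpa [iteratedDeriv_one] using (hf s).hasDerivAt
  | succ m ih =>
    have h : taylorAtZero f (m + 1) = fun s => taylorAtZero f m s +
        (-s) ^ (m + 1) / (Nat.factorial (m + 1) : ℂ) * iteratedDeriv (m + 1) f s :=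
      funext (taylorAtZero_succ f m)
    rw [h]
    have h1 : HasDerivAt (iteratedDeriv (m + 1) f) (iteratedDeriv (m + 2) f s) s := by
      rw [iteratedDeriv_succ (n := m + 1)]
      exact (differentiable_iteratedDeriv hf (m + 1) s).hasDerivAt
    refine (ih.add (((((hasDerivAt_id s).fun_neg.fun_pow (m + 1)).div_const _).fun_mul
      h1))).congr_deriv ?_
    have hm : (m : ℂ) + 1 ≠ 0 := by exact_mod_cast Nat.succ_ne_zero m
    have hm' : (Nat.factorial m : ℂ) ≠ 0 := by exact_mod_cast m.factorial_ne_zero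
    rw [Nat.factorial_succ]
    push_cast
    simp only [id]
    field_simp
    ring

/-- `taylorAtZero f m` in the coordinate `w = (1 - s) / s`. -/
noncomputable def taylorDisc (f : ℂ → ℂ) (m : ℕ) (w : ℂ) : ℂ :=
  taylorAtZero f m (1 + w)⁻¹

lemma one_add_ne_zero_of_mem_ball {w : ℂ} (hw : w ∈ Metric.ball (0 : ℂ) 1) : 1 + w ≠ 0 := by
  intro h
  have : w = -1 := by linear_combination h
  simp [this] at hw

lemma differentiableOn_taylorDisc {f : ℂ → ℂ} (hf : Differentiable ℂ f) (m : ℕ) :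
    DifferentiableOn ℂ (taylorDisc f m) (Metric.ball 0 1) := by
  intro w hw
  have h := one_add_ne_zero_of_mem_ball hw
  have h1 : DifferentiableAt ℂ (fun w : ℂ => (1 + w)⁻¹) w := by fun_prop (disch := exact h)
  exact ((differentiable_taylorAtZero hf m _).comp w h1).differentiableWithinAt

lemma contDiffAt_taylorDisc {f : ℂ → ℂ} (hf : Differentiable ℂ f) (m n : ℕ) :
    ContDiffAt ℂ n (taylorDisc f m) 0 :=
  ((differentiableOn_taylorDisc hf m).analyticAt (Metric.ball_mem_nhds 0 one_pos)).contDiffAt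

lemma one_add_mul_deriv_taylorDisc {f : ℂ → ℂ} (hf : Differentiable ℂ f) (m : ℕ) {w : ℂ}
    (hw : w ∈ Metric.ball (0 : ℂ) 1) :
    (w - -1) * deriv (taylorDisc f m) w =
      (m + 1) * (taylorDisc f (m + 1) w - taylorDisc f m w) := by
  have h := one_add_ne_zero_of_mem_ball hw
  have h1 : HasDerivAt (fun w : ℂ => (1 + w)⁻¹) (-1 / (1 + w) ^ 2) w :=
    ((hasDerivAt_id w).const_add 1).fun_inv h
  have h2 := ((hasDerivAt_taylorAtZero hf m _).comp w h1).deriv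
  have h3 : deriv (taylorDisc f m) w = _ := h2
  rw [h3, taylorDisc, taylorAtZero_succ, taylorDisc, Nat.factorial_succ]
  have hm : (m : ℂ) + 1 ≠ 0 := by exact_mod_cast Nat.succ_ne_zero m
  have hm' : (Nat.factorial m : ℂ) ≠ 0 := by exact_mod_cast m.factorial_ne_zero
  have h4 : w - -1 = 1 + w := by ring
  rw [h4, div_eq_mul_inv (-1), ← inv_pow, pow_succ _ m]
  have h5 : (1 + w) * (1 + w)⁻¹ = 1 := mul_inv_cancel₀ h
  generalize (1 + w)⁻¹ = u at h5 ⊢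
  push_cast
  field_simp
  linear_combination (-(-u) ^ m * u * iteratedDeriv (m + 1) f u) * h5

lemma iteratedDeriv_succ_taylorDisc {f : ℂ → ℂ} (hf : Differentiable ℂ f) (m n : ℕ) :
    iteratedDeriv (n + 1) (taylorDisc f m) 0 =
      (m + 1) * iteratedDeriv n (taylorDisc f (m + 1)) 0 -
        (n + m + 1) * iteratedDeriv n (taylorDisc f m) 0 := by
  have hev : (fun w => (w - -1) * deriv (taylorDisc f m) w) =ᶠ[nhds 0]
      fun w => (m + 1) * (taylorDisc f (m + 1) w - taylorDisc f m w) := by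
    filter_upwards [Metric.ball_mem_nhds (0 : ℂ) one_pos] with w hw
    exact one_add_mul_deriv_taylorDisc hf m hw
  have h := hev.iteratedDeriv_eq n
  rw [iteratedDeriv_const_mul_field, iteratedDeriv_fun_sub (contDiffAt_taylorDisc hf _ _)
    (contDiffAt_taylorDisc hf _ _)] at h
  have hd : ∀ k : ℕ, ContDiffAt ℂ k (deriv (taylorDisc f m)) 0 := fun k =>
    (((differentiableOn_taylorDisc hf m).analyticAt
      (Metric.ball_mem_nhds 0 one_pos)).deriv).contDiffAt
  cases n with
  | zero =>
    simp only [iteratedDeriv_zero, zero_add, iteratedDeriv_one] at h ⊢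
    push_cast
    linear_combination h
  | succ n =>
    rw [iteratedDeriv_succ_sub_const_mul (-1) n (hd _), ← iteratedDeriv_succ',
      ← iteratedDeriv_succ'] at h
    push_cast
    linear_combination h

/-- The partial sums `∑_{j ≤ N} γ_j / j!`. -/
noncomputable def stieltjesSum (N : ℕ) : ℝ :=
  ∑ j ∈ range (N + 1), stieltjes j / (Nat.factorial j : ℝ)

lemma ellGen_eq_fwdDiff (n m : ℕ) :
    ellGen n m = -(if n = 0 then 1 else 0) + (fwdDiff 1)^[n] stieltjesSum m := by
  rw [ellGen, fwdDiff_iter_eq_sum_shift]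
  congr 1
  refine Finset.sum_congr rfl fun k _ => ?_
  rw [stieltjesSum, smul_eq_mul, mul_one, zsmul_eq_mul]
  push_cast
  ring

lemma taylorDisc_riemannZeta₀_zero (m : ℕ) :
    taylorDisc riemannZeta₀ m 0 = (stieltjesSum m : ℂ) := by
  simp only [taylorDisc, add_zero, inv_one, taylorAtZero, stieltjesSum]
  push_cast
  refine Finset.sum_congr rfl fun k _ => ?_
  rw [iteratedDeriv_riemannZeta₀_one]
  have h : (-1 : ℂ) ^ k * (-1) ^ k = 1 := by
    rw [← mul_pow]
    simp
  linear_combination ((stieltjes k : ℂ) / (Nat.factorial k : ℂ)) * h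

lemma iteratedDeriv_taylorDisc_riemannZeta₀ (n m : ℕ) :
    iteratedDeriv n (taylorDisc riemannZeta₀ m) 0 =
      (Nat.factorial n : ℂ) * ((n + m).choose m : ℂ) *
        (((fwdDiff 1)^[n] stieltjesSum m : ℝ) : ℂ) := by
  induction n generalizing m with
  | zero => simp [taylorDisc_riemannZeta₀_zero]
  | succ n ih =>
    rw [iteratedDeriv_succ_taylorDisc differentiable_riemannZeta₀, ih, ih,
      Function.iterate_succ_apply', fwdDiff]
    have h1 : (((n + m + 1).choose m : ℕ) : ℂ) * (n + 1) = (n + m + 1) * ((n + m).choose m : ℕ) := by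
      have := Nat.add_one_mul_choose_eq (n + m) n
      rw [Nat.choose_symm_add, show n + m + 1 = (n + 1) + m by ring, Nat.choose_symm_add] at this
      rw [show n + m + 1 = (n + 1) + m by ring]
      have h := congrArg (Nat.cast : ℕ → ℂ) this
      push_cast at h
      linear_combination -h
    have h2 : (((n + (m + 1)).choose (m + 1) : ℕ) : ℂ) * (m + 1) =
        (n + m + 1) * ((n + m).choose m : ℕ) := by
      have h := congrArg (Nat.cast : ℕ → ℂ) (Nat.add_one_mul_choose_eq (n + m) m)
      push_cast at h
      rw [← add_assoc]
      linear_combination -h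
    rw [Nat.factorial_succ, show n + 1 + m = n + m + 1 by ring]
    push_cast
    linear_combination
      (Nat.factorial n : ℂ) * (((fwdDiff 1)^[n] stieltjesSum (m + 1) : ℝ) : ℂ) * h2 -
      (Nat.factorial n : ℂ) * ((((fwdDiff 1)^[n] stieltjesSum (m + 1) : ℝ) : ℂ) -
        (((fwdDiff 1)^[n] stieltjesSum m : ℝ) : ℂ)) * h1

lemma norm_one_sub_div_lt_one {s : ℂ} (hs : 1 / 2 < s.re) : ‖(1 - s) / s‖ < 1 := by
  have hs0 : s ≠ 0 := by
    rintro rfl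
    norm_num at hs
  rw [norm_div, div_lt_one (norm_pos_iff.mpr hs0), ← sq_lt_sq₀ (norm_nonneg _) (norm_nonneg _),
    Complex.sq_norm, Complex.sq_norm, Complex.normSq_apply, Complex.normSq_apply]
  simp only [Complex.sub_re, Complex.sub_im, Complex.one_re, Complex.one_im]
  nlinarith

/-- The expansion of `taylorAtZero riemannZeta₀ m` in powers of `(1 - s) / s`. -/
lemma hasSum_taylorAtZero_riemannZeta₀ (m : ℕ) {s : ℂ} (hs : 1 / 2 < s.re) :
    HasSum (fun n : ℕ => ((n + m).choose m : ℂ) * (ellGen n m : ℂ) * ((1 - s) / s) ^ n)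
      (taylorAtZero riemannZeta₀ m s - 1) := by
  have hs0 : s ≠ 0 := by
    rintro rfl
    norm_num at hs
  have hball : (1 - s) / s ∈ Metric.ball (0 : ℂ) 1 := by
    rw [mem_ball_zero_iff]
    exact norm_one_sub_div_lt_one hs
  have h := Complex.hasSum_taylorSeries_on_ball
    (differentiableOn_taylorDisc differentiable_riemannZeta₀ m) hball
  have hval : taylorDisc riemannZeta₀ m ((1 - s) / s) = taylorAtZero riemannZeta₀ m s := by
    rw [taylorDisc]
    congr 1
    field_simp
    ring
  rw [hval] at h
  refine (h.sub (hasSum_ite_eq (0 : ℕ) (1 : ℂ))).congr_fun ?_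
  intro n
  rw [iteratedDeriv_taylorDisc_riemannZeta₀, ellGen_eq_fwdDiff]
  have hn : (Nat.factorial n : ℂ) ≠ 0 := by exact_mod_cast n.factorial_ne_zero
  simp only [smul_eq_mul, sub_zero]
  rcases eq_or_ne n 0 with rfl | hn0
  · simp
    ring
  · simp only [hn0, if_false]
    push_cast
    field_simp
    ring

lemma iteratedDeriv_inv_sub_one (k : ℕ) (s : ℂ) :
    iteratedDeriv k (fun z : ℂ => (z - 1)⁻¹) s =
      (-1) ^ k * (Nat.factorial k : ℂ) * ((s - 1) ^ (k + 1))⁻¹ := by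
  have h := congrFun (iter_deriv_inv_linear_sub (𝕜 := ℂ) k 1 1) s
  simp only [one_mul, one_pow, mul_one] at h
  rw [iteratedDeriv_eq_iterate, h, show (-1 - k : ℤ) = -((k + 1 : ℕ) : ℤ) by push_cast; ring,
    zpow_neg, zpow_natCast]

lemma taylorAtZero_inv_sub_one (m : ℕ) {s : ℂ} (hs : s ≠ 1) :
    taylorAtZero (fun z => (z - 1)⁻¹) m s = (s / (s - 1)) ^ (m + 1) - 1 := by
  have hs1 : s - 1 ≠ 0 := sub_ne_zero.mpr hs
  induction m with
  | zero =>
    simp [taylorAtZero]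
    field_simp
    ring
  | succ m ih =>
    rw [taylorAtZero_succ, ih, iteratedDeriv_inv_sub_one]
    have hm : (Nat.factorial (m + 1) : ℂ) ≠ 0 := by exact_mod_cast (m + 1).factorial_ne_zero
    have h : (-1 : ℂ) ^ (m + 1) * (-1) ^ (m + 1) = 1 := by
      rw [← mul_pow]
      simp
    have h2 : (-s) ^ (m + 1) / (Nat.factorial (m + 1) : ℂ) *
        ((-1) ^ (m + 1) * (Nat.factorial (m + 1) : ℂ) * ((s - 1) ^ (m + 1 + 1))⁻¹) =
        s ^ (m + 1) * ((s - 1) ^ (m + 1 + 1))⁻¹ := by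
      rw [neg_pow]
      field_simp
      linear_combination s ^ (m + 1) * h
    rw [h2, div_pow, div_pow]
    field_simp
    ring

lemma taylorAtZero_riemannZeta (m : ℕ) {s : ℂ} (hs : s ≠ 1) :
    taylorAtZero riemannZeta m s =
      (s / (s - 1)) ^ (m + 1) + (taylorAtZero riemannZeta₀ m s - 1) := by
  have hev : riemannZeta =ᶠ[nhds s] fun z => (z - 1)⁻¹ + riemannZeta₀ z := by
    filter_upwards [isOpen_ne.mem_nhds hs] with z hz
    exact riemannZeta_eq_inv_sub_add hz
  have h : taylorAtZero riemannZeta m s =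
      taylorAtZero (fun z => (z - 1)⁻¹) m s + taylorAtZero riemannZeta₀ m s := by
    simp only [taylorAtZero, ← Finset.sum_add_distrib, ← mul_add]
    refine Finset.sum_congr rfl fun k _ => ?_
    rw [hev.iteratedDeriv_eq, iteratedDeriv_fun_add
      (by fun_prop (disch := exact sub_ne_zero.mpr hs))
      differentiable_riemannZeta₀.contDiff.contDiffAt]
  rw [h, taylorAtZero_inv_sub_one m hs]
  ring

theorem statement0 (m : ℕ) (s : ℂ) (hs : 1 / 2 < s.re) :
    (s ≠ 1 →
      Summable (fun n : ℕ => ((n + m).choose m : ℂ) * (ellGen n m : ℂ) * ((1 - s) / s) ^ n) ∧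
      ∑ k ∈ Finset.range (m + 1),
          ((-s) ^ k / (Nat.factorial k : ℂ)) * iteratedDeriv k riemannZeta s =
        (s / (s - 1)) ^ (m + 1) +
          ∑' n : ℕ, ((n + m).choose m : ℂ) * (ellGen n m : ℂ) * ((1 - s) / s) ^ n) ∧
    (s = 1 →
      Tendsto (fun z : ℂ =>
          (∑ k ∈ Finset.range (m + 1),
            ((-z) ^ k / (Nat.factorial k : ℂ)) * iteratedDeriv k riemannZeta z) -
            (z / (z - 1)) ^ (m + 1))
        (nhdsWithin 1 {(1 : ℂ)}ᶜ)
        (nhds (∑' n : ℕ, ((n + m).choose m : ℂ) * (ellGen n m : ℂ) * ((1 - s) / s) ^ n))) := by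
  have hsum := hasSum_taylorAtZero_riemannZeta₀ m hs
  refine ⟨fun hs1 => ⟨hsum.summable, ?_⟩, ?_⟩
  · rw [hsum.tsum_eq]
    exact taylorAtZero_riemannZeta m hs1
  · rintro rfl
    rw [hsum.tsum_eq]
    have hcont : ContinuousAt (fun z => taylorAtZero riemannZeta₀ m z - 1) 1 :=
      ((differentiable_taylorAtZero differentiable_riemannZeta₀ m).sub_const 1).continuous.continuousAt
    refine (hcont.tendsto.mono_left nhdsWithin_le_nhds).congr' ?_
    filter_upwards [self_mem_nhdsWithin] with z hz
    have h := taylorAtZero_riemannZeta m (show z ≠ 1 from hz)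
    rw [taylorAtZero] at h
    rw [h]
    ring
end

section
/- For every nonnegative integer n, ℓ_n = (−1)^{n−1} ∫_{1}^{∞} ({x}/x²) · L_n(log x) dx, where {x} = x − ⌊x⌋ is the fractional part and L_n is the n-th Laguerre polynomial. In particular the integral converges. -/
open Filter Finset MeasureTheory

/-- The `n`-th Laguerre polynomial `L_n(u) = ∑_{k=0}^n C(n,k) (-1)^k u^k / k!`. -/
noncomputable def laguerre (n : ℕ) (u : ℝ) : ℝ :=
  ∑ k ∈ Finset.range (n + 1), (n.choose k : ℝ) * (-1 : ℝ) ^ k * u ^ k / (Nat.factorial k : ℝ)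
/-- The Fourier coefficients `ℓ_n`: `ℓ_0 = γ_0 - 1` and, for `n ≥ 1`,
`ℓ_n = ∑_{k=1}^n C(n-1,k-1) (-1)^{n-k} γ_k / k!`. -/
noncomputable def ellSeq (n : ℕ) : ℝ :=
  if n = 0 then stieltjes 0 - 1
  else ∑ k ∈ Finset.Icc 1 n,
    ((n - 1).choose (k - 1) : ℝ) * (-1 : ℝ) ^ (n - k) * stieltjes k / (Nat.factorial k : ℝ)

/-- The integrand of the moments `∫₁^∞ {x} (log x)^k / x² dx`. -/
noncomputable def fractLogPow (k : ℕ) (x : ℝ) : ℝ :=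
  Int.fract x / x ^ 2 * Real.log x ^ k

lemma integrableOn_fractLogPow (k : ℕ) : IntegrableOn (fractLogPow k) (Set.Ioi (1 : ℝ)) := by
  have hdom : IntegrableOn (fun x : ℝ => (2 ^ k * k.factorial : ℝ) * x ^ (-(3 / 2) : ℝ))
      (Set.Ioi (1 : ℝ)) :=
    (integrableOn_Ioi_rpow_of_lt (by norm_num) one_pos).const_mul _
  refine hdom.mono' ?_ ?_
  · refine Measurable.aestronglyMeasurable ?_
    unfold fractLogPow
    exact (measurable_fract.div (measurable_id.pow_const 2)).mul (Real.measurable_log.pow_const k)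
  · refine (ae_restrict_iff' measurableSet_Ioi).2 (ae_of_all _ fun x hx => ?_)
    have hx1 : (1 : ℝ) < x := hx
    have hx0 : (0 : ℝ) < x := one_pos.trans hx1
    have hlog : 0 ≤ Real.log x := Real.log_nonneg hx1.le
    have hexp := Real.pow_div_factorial_le_exp (Real.log x / 2) (by positivity) k
    have hroot : Real.exp (Real.log x / 2) = x ^ (1 / 2 : ℝ) := by
      rw [Real.rpow_def_of_pos hx0]; ring_nf
    have hpow : x ^ (-(3 / 2) : ℝ) = x ^ (1 / 2 : ℝ) / x ^ 2 := by
      rw [← Real.rpow_natCast x 2, ← Real.rpow_sub hx0]; norm_num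
    have hfac : (0 : ℝ) < k.factorial := by positivity
    have hle : Real.log x ^ k ≤ 2 ^ k * k.factorial * x ^ (1 / 2 : ℝ) := by
      rw [hroot, div_pow, div_div, div_le_iff₀ (by positivity)] at hexp
      linarith
    have hfr0 := Int.fract_nonneg x
    have hfr1 := (Int.fract_lt_one x).le
    unfold fractLogPow
    rw [Real.norm_of_nonneg (by positivity), hpow]
    calc Int.fract x / x ^ 2 * Real.log x ^ k
        ≤ 1 / x ^ 2 * (2 ^ k * k.factorial * x ^ (1 / 2 : ℝ)) := by gcongr
      _ = _ := by ring

/-- On each unit interval `(N, N + 1)`, this is `{x}` times the derivative of `(log x)^n / x`. -/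
lemma integrableOn_fractLogPow_sub (n : ℕ) :
    IntegrableOn (fun x => (n : ℝ) * fractLogPow (n - 1) x - fractLogPow n x)
      (Set.Ioi (1 : ℝ)) :=
  ((integrableOn_fractLogPow (n - 1)).const_mul _).sub (integrableOn_fractLogPow n)

lemma integral_unit_fractLogPow_sub (n N : ℕ) (hN : 1 ≤ N) :
    ∫ x in (N : ℝ)..((N : ℝ) + 1), ((n : ℝ) * fractLogPow (n - 1) x - fractLogPow n x) =
      Real.log ((N : ℝ) + 1) ^ n / ((N : ℝ) + 1) -
        (Real.log ((N : ℝ) + 1) ^ (n + 1) / ((n : ℝ) + 1) -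
          Real.log (N : ℝ) ^ (n + 1) / ((n : ℝ) + 1)) := by
  have hN1 : (1 : ℝ) ≤ N := by exact_mod_cast hN
  have hne : ∀ x ∈ Set.Icc (N : ℝ) (N + 1), x ≠ 0 := fun x hx => by
    have := hx.1
    linarith
  have key := intervalIntegral.integral_eq_sub_of_hasDerivAt_of_le
    (f := fun x : ℝ => (x - N) * (Real.log x ^ n / x) - Real.log x ^ (n + 1) / ((n : ℝ) + 1))
    (f' := fun x => (n : ℝ) * fractLogPow (n - 1) x - fractLogPow n x)
    (a := (N : ℝ)) (b := (N : ℝ) + 1) (by linarith) ?_ ?_ ?_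
  · rw [key]
    ring
  · have hlog : ContinuousOn Real.log (Set.Icc (N : ℝ) (N + 1)) :=
      Real.continuousOn_log.mono fun x hx => hne x hx
    exact ((continuousOn_id.sub continuousOn_const).mul
      ((hlog.pow n).div continuousOn_id hne)).sub ((hlog.pow (n + 1)).div_const _)
  · intro x hx
    have hx0 : x ≠ 0 := hne x (Set.Ioo_subset_Icc_self hx)
    have hfract : Int.fract x = x - N := by
      rw [Int.fract_eq_iff]
      exact ⟨by linarith [hx.1], by linarith [hx.2], N, by push_cast; ring⟩
    have hlog := Real.hasDerivAt_log hx0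
    have hn : (n : ℝ) + 1 ≠ 0 := by positivity
    have hderiv := (((hasDerivAt_id x).sub_const (N : ℝ)).mul
      ((hlog.pow n).div (hasDerivAt_id x) hx0)).sub ((hlog.pow (n + 1)).div_const ((n : ℝ) + 1))
    refine hderiv.congr_deriv ?_
    simp only [fractLogPow, hfract, id, Pi.div_apply, Pi.pow_apply, Nat.add_sub_cancel]
    push_cast
    field_simp
    ring
  · rw [intervalIntegrable_iff_integrableOn_Ioc_of_le (by linarith)]
    exact (integrableOn_fractLogPow_sub n).mono_set fun x hx => hN1.trans_lt hx.1

lemma sum_log_pow_div_sub_eq (n N : ℕ) (hN : 1 ≤ N) :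
    (∑ k ∈ Finset.range N, Real.log ((k : ℝ) + 1) ^ n / ((k : ℝ) + 1)) -
      Real.log (N : ℝ) ^ (n + 1) / ((n : ℝ) + 1) =
    0 ^ n + ∫ x in (1 : ℝ)..N, ((n : ℝ) * fractLogPow (n - 1) x - fractLogPow n x) := by
  have hint : ∀ a b : ℝ, 1 ≤ a → a ≤ b → IntervalIntegrable
      (fun x => (n : ℝ) * fractLogPow (n - 1) x - fractLogPow n x) volume a b := fun a b ha hab => by
    rw [intervalIntegrable_iff_integrableOn_Ioc_of_le hab]
    exact (integrableOn_fractLogPow_sub n).mono_set fun x hx => ha.trans_lt hx.1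
  induction N, hN using Nat.le_induction with
  | base => simp
  | succ N hN ih =>
    have hN1 : (1 : ℝ) ≤ N := by exact_mod_cast hN
    push_cast
    rw [Finset.sum_range_succ, ← intervalIntegral.integral_add_adjacent_intervals
      (hint 1 N le_rfl hN1) (hint N (N + 1) hN1 (by linarith)),
      integral_unit_fractLogPow_sub n N hN]
    linarith

lemma stieltjes_eq_integral (n : ℕ) :
    stieltjes n = 0 ^ n + ((n : ℝ) * (∫ x in Set.Ioi (1 : ℝ), fractLogPow (n - 1) x) -
      ∫ x in Set.Ioi (1 : ℝ), fractLogPow n x) := by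
  rw [← integral_const_mul, ← integral_sub ((integrableOn_fractLogPow (n - 1)).const_mul _)
    (integrableOn_fractLogPow n)]
  refine Tendsto.limUnder_eq ?_
  refine ((intervalIntegral_tendsto_integral_Ioi 1 (integrableOn_fractLogPow_sub n)
    tendsto_natCast_atTop_atTop).const_add (0 ^ n)).congr' ?_
  filter_upwards [eventually_ge_atTop 1] with N hN
  exact (sum_log_pow_div_sub_eq n N hN).symm

/-- Summation by parts for alternating binomial sums, via Pascal's rule. -/
lemma sum_choose_alternating_sub (J : ℕ → ℝ) (m : ℕ) :
    ∑ k ∈ Finset.range (m + 1), (m.choose k : ℝ) * (-1) ^ k * (J k - J (k + 1)) =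
      ∑ k ∈ Finset.range (m + 2), ((m + 1).choose k : ℝ) * (-1) ^ k * J k := by
  rw [Finset.sum_range_succ' _ (m + 1)]
  simp only [Nat.choose_succ_succ, Nat.cast_add, add_mul, Finset.sum_add_distrib, mul_sub,
    Finset.sum_sub_distrib]
  have hlast : ∑ k ∈ Finset.range (m + 1), (m.choose (k + 1) : ℝ) * (-1) ^ (k + 1) * J (k + 1) +
      J 0 = ∑ k ∈ Finset.range (m + 1), (m.choose k : ℝ) * (-1) ^ k * J k := by
    rw [Finset.sum_range_succ, Finset.sum_range_succ' _ m]
    simp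
  rw [← hlast]
  simp only [pow_succ, mul_neg, mul_one, neg_mul, Finset.sum_neg_distrib, Nat.choose_zero_right,
    pow_zero, Nat.cast_one, one_mul]
  ring

lemma fract_mul_laguerre_eq (n : ℕ) :
    (fun x : ℝ => Int.fract x / x ^ 2 * laguerre n (Real.log x)) = fun x =>
      ∑ k ∈ Finset.range (n + 1),
        ((n.choose k : ℝ) * (-1) ^ k / (Nat.factorial k : ℝ)) * fractLogPow k x := by
  funext x
  rw [laguerre, Finset.mul_sum]
  refine Finset.sum_congr rfl fun k _ => ?_
  rw [fractLogPow]
  ring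

theorem statement2 (n : ℕ) :
    IntegrableOn (fun x : ℝ => Int.fract x / x ^ 2 * laguerre n (Real.log x))
      (Set.Ioi (1 : ℝ)) ∧
    ellSeq n = (-1 : ℝ) ^ (n + 1) *
      ∫ x in Set.Ioi (1 : ℝ), Int.fract x / x ^ 2 * laguerre n (Real.log x) := by
  have hint : ∀ k ∈ Finset.range (n + 1), IntegrableOn (fun x =>
      ((n.choose k : ℝ) * (-1) ^ k / (Nat.factorial k : ℝ)) * fractLogPow k x)
      (Set.Ioi (1 : ℝ)) := fun k _ => (integrableOn_fractLogPow k).const_mul _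
  rw [fract_mul_laguerre_eq]
  refine ⟨integrable_finsetSum _ hint, ?_⟩
  rw [integral_finsetSum _ hint]
  simp only [integral_const_mul]
  cases n with
  | zero => simp [ellSeq, stieltjes_eq_integral]
  | succ m =>
    have hparts := sum_choose_alternating_sub
      (fun k => (∫ x in Set.Ioi (1 : ℝ), fractLogPow k x) / (Nat.factorial k : ℝ)) m
    have hright : ∑ k ∈ Finset.range (m + 1 + 1),
        ((m + 1).choose k : ℝ) * (-1) ^ k / (Nat.factorial k : ℝ) *
          (∫ x in Set.Ioi (1 : ℝ), fractLogPow k x) =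
        ∑ k ∈ Finset.range (m + 2), ((m + 1).choose k : ℝ) * (-1) ^ k *
          ((∫ x in Set.Ioi (1 : ℝ), fractLogPow k x) / (Nat.factorial k : ℝ)) :=
      Finset.sum_congr rfl fun k _ => by ring
    rw [hright, ← hparts, ellSeq, if_neg m.succ_ne_zero, Finset.mul_sum,
      ← Finset.Ico_add_one_right_eq_Icc, Finset.sum_Ico_eq_sum_range]
    refine Finset.sum_congr rfl fun k hk => ?_
    have hkm : k ≤ m := Nat.lt_succ_iff.1 (Finset.mem_range.1 hk)
    have hsign : (-1 : ℝ) ^ (m + 1 - (1 + k)) = (-1) ^ (m + 1 + 1) * (-1) ^ k := by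
      obtain ⟨d, rfl⟩ := Nat.exists_eq_add_of_le hkm
      rw [show k + d + 1 - (1 + k) = d by omega, ← pow_add,
        show k + d + 1 + 1 + k = d + 2 * (k + 1) by ring, pow_add, pow_mul]
      simp
    rw [hsign, stieltjes_eq_integral, add_comm 1 k, zero_pow k.succ_ne_zero, Nat.factorial_succ]
    simp only [Nat.add_sub_cancel]
    push_cast
    field_simp
    ring
end

section
/- For every real x > 1, the series ∑_{n=0}^{∞} (−1)^{n−1} ℓ_n · L_n(log x) converges, and its sum equals 1/2 if x is an integer, and equals the fractional part {x} = x − ⌊x⌋ otherwise. -/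
open Filter Finset MeasureTheory
open scoped Classical

/-- The image of the Laguerre polynomial `L_n` under the Euler operator `u * d/du`. -/
noncomputable def eulerLaguerre (n : ℕ) (u : ℝ) : ℝ :=
  ∑ k ∈ range (n + 1), (k : ℝ) * (n.choose k : ℝ) * (-1 : ℝ) ^ k * u ^ k / (Nat.factorial k : ℝ)

lemma laguerre_zero (u : ℝ) : laguerre 0 u = 1 := by simp [laguerre]

lemma eulerLaguerre_zero (u : ℝ) : eulerLaguerre 0 u = 0 := by simp [eulerLaguerre]

lemma laguerre_apply_zero (n : ℕ) : laguerre n 0 = 1 := by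
  rw [laguerre, sum_range_succ']
  simp

lemma laguerre_eq_sum_range_add_two (n : ℕ) (u : ℝ) :
    laguerre n u = ∑ k ∈ range (n + 2),
      (n.choose k : ℝ) * (-1 : ℝ) ^ k * u ^ k / (Nat.factorial k : ℝ) := by
  rw [sum_range_succ _ (n + 1), laguerre]
  simp

lemma eulerLaguerre_succ (n : ℕ) (u : ℝ) :
    eulerLaguerre (n + 1) u = eulerLaguerre n u - u * laguerre n u := by
  have h : eulerLaguerre n u = ∑ k ∈ range (n + 2),
      (k : ℝ) * (n.choose k : ℝ) * (-1 : ℝ) ^ k * u ^ k / (Nat.factorial k : ℝ) := by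
    rw [sum_range_succ _ (n + 1), eulerLaguerre]
    simp
  rw [h, eulerLaguerre, sum_range_succ' _ (n + 1), sum_range_succ' _ (n + 1), laguerre, mul_sum]
  simp only [Nat.cast_zero, zero_mul, zero_div, add_zero]
  rw [← sum_sub_distrib]
  refine sum_congr rfl fun k _ => ?_
  have hk : (k.factorial : ℝ) ≠ 0 := by positivity
  rw [Nat.choose_succ_succ, Nat.factorial_succ]
  push_cast
  field_simp
  ring

lemma succ_mul_laguerre_succ_sub (n : ℕ) (u : ℝ) :
    ((n : ℝ) + 1) * (laguerre (n + 1) u - laguerre n u) = eulerLaguerre (n + 1) u := by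
  rw [laguerre_eq_sum_range_add_two n, laguerre, eulerLaguerre, ← sum_sub_distrib, mul_sum]
  refine sum_congr rfl fun k hk => ?_
  have hk' : k ≤ n + 1 := by simpa [Nat.lt_succ_iff] using hk
  have h := congrArg (Nat.cast (R := ℝ)) (Nat.choose_mul_succ_eq n k)
  push_cast [Nat.cast_sub hk'] at h
  linear_combination (-(-1 : ℝ) ^ k * u ^ k / (Nat.factorial k : ℝ)) * h

lemma laguerre_succ (n : ℕ) (u : ℝ) :
    laguerre (n + 1) u = laguerre n u + eulerLaguerre (n + 1) u / ((n : ℝ) + 1) := by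
  have : ((n : ℝ) + 1) ≠ 0 := by positivity
  rw [← succ_mul_laguerre_succ_sub]
  field_simp
  ring

lemma differentiable_laguerre (n : ℕ) : Differentiable ℝ (laguerre n) := by
  unfold laguerre
  fun_prop

lemma differentiable_eulerLaguerre (n : ℕ) : Differentiable ℝ (eulerLaguerre n) := by
  unfold eulerLaguerre
  fun_prop

lemma continuous_laguerre (n : ℕ) : Continuous (laguerre n) :=
  (differentiable_laguerre n).continuous

lemma continuous_eulerLaguerre (n : ℕ) : Continuous (eulerLaguerre n) :=
  (differentiable_eulerLaguerre n).continuous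

lemma laguerre_derivatives (n : ℕ) (u : ℝ) :
    u * deriv (laguerre n) u = eulerLaguerre n u ∧
    HasDerivAt (eulerLaguerre n) (eulerLaguerre n u - n * laguerre n u) u := by
  induction n with
  | zero =>
    have h0 : laguerre 0 = fun _ => 1 := funext laguerre_zero
    have h1 : eulerLaguerre 0 = fun _ => 0 := funext eulerLaguerre_zero
    rw [h0, h1]
    simpa using hasDerivAt_const u (0 : ℝ)
  | succ n ih =>
    obtain ⟨h1, h2⟩ := ih
    have hL := ((differentiable_laguerre n) u).hasDerivAt
    have hne : ((n : ℝ) + 1) ≠ 0 := by positivity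
    have hP : HasDerivAt (eulerLaguerre (n + 1)) (-((n : ℝ) + 1) * laguerre n u) u := by
      have h3 : eulerLaguerre (n + 1) = fun u => eulerLaguerre n u - u * laguerre n u :=
        funext (eulerLaguerre_succ n)
      rw [h3]
      refine (h2.sub ((hasDerivAt_id u).mul hL)).congr_deriv ?_
      simp only [id]
      linear_combination -h1
    have hL' : HasDerivAt (laguerre (n + 1)) (deriv (laguerre n) u - laguerre n u) u := by
      have h3 : laguerre (n + 1) = fun u =>
          laguerre n u + eulerLaguerre (n + 1) u / ((n : ℝ) + 1) :=
        funext (laguerre_succ n)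
      rw [h3]
      refine (hL.add (hP.div_const ((n : ℝ) + 1))).congr_deriv ?_
      rw [mul_div_right_comm, neg_div, div_self hne]
      ring
    refine ⟨?_, ?_⟩
    · rw [hL'.deriv, eulerLaguerre_succ]
      linear_combination h1
    · refine hP.congr_deriv ?_
      push_cast
      linear_combination succ_mul_laguerre_succ_sub n u

lemma hasDerivAt_eulerLaguerre (n : ℕ) (u : ℝ) :
    HasDerivAt (eulerLaguerre n) (eulerLaguerre n u - n * laguerre n u) u :=
  (laguerre_derivatives n u).2

lemma hasDerivAt_laguerre (n : ℕ) {u : ℝ} (hu : u ≠ 0) :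
    HasDerivAt (laguerre n) (eulerLaguerre n u / u) u := by
  have h := ((differentiable_laguerre n) u).hasDerivAt
  rwa [eq_div_of_mul_eq hu ((mul_comm _ _).trans (laguerre_derivatives n u).1)] at h

lemma hasDerivAt_mul_laguerre (n : ℕ) (u : ℝ) :
    HasDerivAt (fun u => u * laguerre n u) (laguerre n u + eulerLaguerre n u) u := by
  refine ((hasDerivAt_id u).mul ((differentiable_laguerre n) u).hasDerivAt).congr_deriv ?_
  simp only [id]
  linear_combination (laguerre_derivatives n u).1

/-- The Christoffel–Darboux formula. -/
lemma sub_mul_sum_laguerre_mul (N : ℕ) (u t : ℝ) :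
    (t - u) * ∑ n ∈ range N, laguerre n u * laguerre n t =
      laguerre N t * eulerLaguerre N u - laguerre N u * eulerLaguerre N t := by
  induction N with
  | zero => simp [eulerLaguerre_zero]
  | succ N ih =>
    rw [sum_range_succ, mul_add, ih, laguerre_succ, laguerre_succ, eulerLaguerre_succ,
      eulerLaguerre_succ]
    ring

lemma abs_laguerre_term (n k : ℕ) (u : ℝ) (hu : 0 ≤ u) :
    |(n.choose k : ℝ) * (-1 : ℝ) ^ k * u ^ k / (Nat.factorial k : ℝ)| =
      (n.choose k : ℝ) * (u ^ k / (Nat.factorial k : ℝ)) := by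
  rw [abs_div, abs_mul, abs_mul, abs_pow, abs_pow, abs_neg, abs_one, one_pow, mul_one,
    abs_of_nonneg hu, Nat.abs_cast, Nat.abs_cast, mul_div_assoc]

lemma abs_laguerre_le_sum (n : ℕ) {u : ℝ} (hu : 0 ≤ u) :
    |laguerre n u| ≤ ∑ k ∈ range (n + 1), (n.choose k : ℝ) * (u ^ k / (Nat.factorial k : ℝ)) := by
  refine (abs_sum_le_sum_abs _ _).trans (sum_le_sum fun k _ => ?_)
  rw [abs_laguerre_term n k u hu]

lemma abs_eulerLaguerre_le_sum (n : ℕ) {u : ℝ} (hu : 0 ≤ u) :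
    |eulerLaguerre n u| ≤
      ∑ k ∈ range (n + 1), (k : ℝ) * ((n.choose k : ℝ) * (u ^ k / (Nat.factorial k : ℝ))) := by
  refine (abs_sum_le_sum_abs _ _).trans (sum_le_sum fun k _ => ?_)
  rw [← abs_laguerre_term n k u hu, mul_assoc, mul_assoc, mul_div_assoc, abs_mul, Nat.abs_cast,
    mul_assoc]

lemma choose_mul_pow_le_inv_factorial (n k : ℕ) {u : ℝ} (hu : 0 ≤ u) (hnu : n * u ≤ 1) :
    (n.choose k : ℝ) * u ^ k ≤ 1 / (Nat.factorial k : ℝ) := by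
  calc (n.choose k : ℝ) * u ^ k ≤ ((n : ℝ) ^ k / (Nat.factorial k : ℝ)) * u ^ k := by
        gcongr
        exact Nat.choose_le_pow_div k n
    _ = (n * u) ^ k / (Nat.factorial k : ℝ) := by ring
    _ ≤ 1 / (Nat.factorial k : ℝ) := by
        gcongr
        exact pow_le_one₀ (by positivity) hnu

lemma sum_inv_factorial_le_exp_one (n : ℕ) :
    ∑ k ∈ range n, 1 / (Nat.factorial k : ℝ) ≤ Real.exp 1 := by
  simpa using Real.sum_le_exp_of_nonneg zero_le_one n

lemma abs_laguerre_le_exp_one (n : ℕ) {u : ℝ} (hu : 0 ≤ u) (hnu : n * u ≤ 1) :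
    |laguerre n u| ≤ Real.exp 1 := by
  refine (abs_laguerre_le_sum n hu).trans
    ((sum_le_sum fun k _ => ?_).trans (sum_inv_factorial_le_exp_one (n + 1)))
  have h1 : (1 : ℝ) ≤ Nat.factorial k := by exact_mod_cast Nat.factorial_pos k
  rw [← mul_div_assoc]
  exact (div_le_self (by positivity) h1).trans (choose_mul_pow_le_inv_factorial n k hu hnu)

lemma abs_eulerLaguerre_le_exp_one (n : ℕ) {u : ℝ} (hu : 0 ≤ u) (hnu : n * u ≤ 1) :
    |eulerLaguerre n u| ≤ Real.exp 1 := by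
  refine (abs_eulerLaguerre_le_sum n hu).trans
    ((sum_le_sum fun k _ => ?_).trans (sum_inv_factorial_le_exp_one (n + 1)))
  have h1 : (k : ℝ) ≤ Nat.factorial k := by exact_mod_cast Nat.self_le_factorial k
  have h2 : (0 : ℝ) < Nat.factorial k := by positivity
  calc (k : ℝ) * ((n.choose k : ℝ) * (u ^ k / (Nat.factorial k : ℝ)))
      = (k : ℝ) / (Nat.factorial k : ℝ) * ((n.choose k : ℝ) * u ^ k) := by ring
    _ ≤ 1 * ((n.choose k : ℝ) * u ^ k) := by
        gcongr
        exact (div_le_one h2).2 h1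
    _ ≤ 1 / (Nat.factorial k : ℝ) := by
        rw [one_mul]
        exact choose_mul_pow_le_inv_factorial n k hu hnu

lemma sum_choose_mul_pow_div_factorial_le (n : ℕ) {u : ℝ} (hu : 0 ≤ u) (hnu : 3 * n ≤ u) :
    ∑ k ∈ range (n + 1), (n.choose k : ℝ) * (u ^ k / (Nat.factorial k : ℝ)) ≤
      Real.exp (5 * u / 6) := by
  have h4 : (4 : ℝ) ≤ Real.exp (3 / 2) := by
    have h := Real.quadratic_le_exp_of_nonneg (x := 3 / 4) (by norm_num)
    have h' : Real.exp (3 / 2) = Real.exp (3 / 4) ^ 2 := by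
      rw [← Real.exp_nat_mul]; norm_num
    rw [h']
    norm_num at h ⊢
    nlinarith
  calc ∑ k ∈ range (n + 1), (n.choose k : ℝ) * (u ^ k / (Nat.factorial k : ℝ))
      ≤ ∑ k ∈ range (n + 1), 3 ^ k * 1 ^ (n - k) * (n.choose k : ℝ) * Real.exp (u / 3) := by
        refine sum_le_sum fun k _ => ?_
        have h := Real.pow_div_factorial_le_exp (u / 3) (by positivity) k
        have h' : u ^ k / (Nat.factorial k : ℝ) =
            3 ^ k * ((u / 3) ^ k / (Nat.factorial k : ℝ)) := by
          rw [div_pow]; field_simp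
        rw [h', one_pow, mul_one, mul_left_comm, mul_assoc]
        gcongr
    _ = 4 ^ n * Real.exp (u / 3) := by
        rw [← sum_mul, ← add_pow]; norm_num
    _ ≤ Real.exp (3 / 2) ^ n * Real.exp (u / 3) := by gcongr
    _ ≤ Real.exp (5 * u / 6) := by
        rw [← Real.exp_nat_mul, ← Real.exp_add, Real.exp_le_exp]
        linarith

lemma abs_laguerre_le_exp (n : ℕ) {u : ℝ} (hu : 0 ≤ u) (hnu : 3 * n ≤ u) :
    |laguerre n u| ≤ Real.exp (5 * u / 6) :=
  (abs_laguerre_le_sum n hu).trans (sum_choose_mul_pow_div_factorial_le n hu hnu)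

lemma abs_eulerLaguerre_le_exp (n : ℕ) {u : ℝ} (hu : 0 ≤ u) (hnu : 3 * n ≤ u) :
    |eulerLaguerre n u| ≤ n * Real.exp (5 * u / 6) := by
  refine (abs_eulerLaguerre_le_sum n hu).trans (le_trans ?_
    (mul_le_mul_of_nonneg_left (sum_choose_mul_pow_div_factorial_le n hu hnu) n.cast_nonneg))
  rw [mul_sum]
  refine sum_le_sum fun k hk => ?_
  have hk' : (k : ℝ) ≤ n := by exact_mod_cast Nat.lt_succ_iff.1 (mem_range.1 hk)
  gcongr

/-- An energy of Sonin type for the differential equation satisfied by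
`r ^ (1 / 2) * exp (-r ^ 2 / 2) * L_n (r ^ 2)`, in the variable `t = r ^ 2`. -/
noncomputable def laguerreEnergy (n : ℕ) (t : ℝ) : ℝ :=
  Real.exp (-t) * (((1 / 2 - t) * laguerre n t + 2 * eulerLaguerre n t) ^ 2 / √t +
    (4 * n + 2 - t + 1 / (4 * t)) * √t * laguerre n t ^ 2)

lemma hasDerivAt_laguerreEnergy (n : ℕ) {t : ℝ} (ht : 0 < t) :
    HasDerivAt (laguerreEnergy n)
      (-((1 + 1 / (4 * t ^ 2)) * √t * Real.exp (-t) * laguerre n t ^ 2)) t := by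
  have hs : 0 < √t := Real.sqrt_pos.2 ht
  have hsq : √t ^ 2 = t := Real.sq_sqrt ht.le
  have hL := hasDerivAt_laguerre n ht.ne'
  have hP := hasDerivAt_eulerLaguerre n t
  have hS := Real.hasDerivAt_sqrt ht.ne'
  have hE : HasDerivAt (fun t : ℝ => Real.exp (-t)) (-Real.exp (-t)) t := by
    simpa using (hasDerivAt_neg t).exp
  have hA := (((hasDerivAt_id t).const_sub (1 / 2)).mul hL).add (hP.const_mul 2)
  have hq := ((hasDerivAt_id t).const_sub (4 * n + 2 : ℝ)).add
    (((hasDerivAt_id t).const_mul 4).fun_inv (by simpa using ht.ne'))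
  have h := hE.mul (((hA.pow 2).div hS hs.ne').add ((hq.mul hS).mul (hL.pow 2)))
  refine (h.congr_of_eventuallyEq (Eventually.of_forall fun y => ?_)).congr_deriv ?_
  · simp [laguerreEnergy]
  · simp only [id, Pi.add_apply, Pi.mul_apply, Pi.pow_apply, Pi.div_apply]
    generalize laguerre n t = L
    generalize eulerLaguerre n t = P
    generalize Real.exp (-t) = E
    generalize √t = s at *
    subst hsq
    field_simp
    ring

lemma antitoneOn_laguerreEnergy (n : ℕ) : AntitoneOn (laguerreEnergy n) (Set.Ioi 0) := by
  refine antitoneOn_of_deriv_nonpos (convex_Ioi 0)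
    (fun t ht => (hasDerivAt_laguerreEnergy n ht).continuousAt.continuousWithinAt) ?_ ?_
  · rw [interior_Ioi]
    exact fun t ht => (hasDerivAt_laguerreEnergy n ht).differentiableAt.differentiableWithinAt
  · rw [interior_Ioi]
    intro t ht
    rw [(hasDerivAt_laguerreEnergy n ht).deriv, neg_nonpos]
    have : 0 < t := ht
    positivity

lemma exp_one_sq_le : Real.exp 1 ^ 2 ≤ 8 := by
  have h := Real.exp_one_lt_d9
  have h' := Real.exp_pos 1
  nlinarith

lemma laguerreEnergy_inv_le {n : ℕ} (hn : 1 ≤ n) : laguerreEnergy n (n : ℝ)⁻¹ ≤ 100 * √n := by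
  have hn' : (1 : ℝ) ≤ n := by exact_mod_cast hn
  have hn0 : (n : ℝ) ≠ 0 := by positivity
  have h1 := abs_laguerre_le_exp_one n (u := (n : ℝ)⁻¹) (by positivity) (by field_simp; rfl)
  have h2 := abs_eulerLaguerre_le_exp_one n (u := (n : ℝ)⁻¹) (by positivity) (by field_simp; rfl)
  have he := exp_one_sq_le
  have hi : (n : ℝ)⁻¹ ≤ 1 := inv_le_one_of_one_le₀ hn'
  have hi0 : 0 < (n : ℝ)⁻¹ := by positivity
  have hA : ((1 / 2 - (n : ℝ)⁻¹) * laguerre n (n : ℝ)⁻¹ + 2 * eulerLaguerre n (n : ℝ)⁻¹) ^ 2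
      ≤ 50 := by
    have h3 : |(1 / 2 - (n : ℝ)⁻¹) * laguerre n (n : ℝ)⁻¹ + 2 * eulerLaguerre n (n : ℝ)⁻¹| ≤
        1 / 2 * Real.exp 1 + 2 * Real.exp 1 := by
      refine (abs_add_le _ _).trans (add_le_add ?_ ?_)
      · rw [abs_mul]
        gcongr
        rw [abs_le]
        constructor <;> linarith
      · rw [abs_mul, abs_two]
        gcongr
    calc _ = |(1 / 2 - (n : ℝ)⁻¹) * laguerre n (n : ℝ)⁻¹ + 2 * eulerLaguerre n (n : ℝ)⁻¹| ^ 2 :=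
          (sq_abs _).symm
      _ ≤ (1 / 2 * Real.exp 1 + 2 * Real.exp 1) ^ 2 := by gcongr
      _ ≤ 50 := by nlinarith
  have hL : laguerre n (n : ℝ)⁻¹ ^ 2 ≤ 8 := by
    rw [← sq_abs]
    exact (pow_le_pow_left₀ (abs_nonneg _) h1 2).trans he
  have hs : 0 < √(n : ℝ) := by positivity
  have hsq : √(n : ℝ) ^ 2 = n := Real.sq_sqrt (by positivity)
  have hq : (4 * (n : ℝ) + 2 - (n : ℝ)⁻¹ + 1 / (4 * (n : ℝ)⁻¹)) ≤ 25 / 4 * n := by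
    have : 1 / (4 * (n : ℝ)⁻¹) = n / 4 := by field_simp
    rw [this]
    linarith
  unfold laguerreEnergy
  rw [Real.sqrt_inv, div_inv_eq_mul]
  have hexp : Real.exp (-(n : ℝ)⁻¹) ≤ 1 := Real.exp_le_one_iff.2 (by linarith)
  calc _ ≤ 1 * (50 * √(n : ℝ) + (25 / 4 * n) * (√(n : ℝ))⁻¹ * 8) := by
        have hq0 : 0 ≤ 4 * (n : ℝ) + 2 - (n : ℝ)⁻¹ + 1 / (4 * (n : ℝ)⁻¹) := by
          have : 0 ≤ 1 / (4 * (n : ℝ)⁻¹) := by positivity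
          linarith
        gcongr
    _ = 100 * √n := by
        nth_rewrite 2 [← hsq]
        field_simp
        ring

lemma sqrt_mul_laguerre_sq_le_of_energy {n : ℕ} (hn : 1 ≤ n) {t : ℝ} (h1 : (n : ℝ)⁻¹ ≤ t)
    (h2 : t ≤ 3 * n) :
    √n * √t * laguerre n t ^ 2 ≤ 100 * Real.exp t ∧
    ((1 / 2 - t) * laguerre n t + 2 * eulerLaguerre n t) ^ 2 ≤ 100 * √n * √t * Real.exp t := by
  have hn' : (1 : ℝ) ≤ n := by exact_mod_cast hn
  have hi0 : 0 < (n : ℝ)⁻¹ := by positivity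
  have ht : 0 < t := hi0.trans_le h1
  have hE := (antitoneOn_laguerreEnergy n hi0 ht h1).trans (laguerreEnergy_inv_le hn)
  have hs : 0 < √(n : ℝ) := by positivity
  have hsq : √(n : ℝ) ^ 2 = n := Real.sq_sqrt (by positivity)
  have hst : 0 < √t := by positivity
  have hq : (n : ℝ) ≤ 4 * n + 2 - t + 1 / (4 * t) := by
    have : 0 ≤ 1 / (4 * t) := by positivity
    linarith
  have hexp : Real.exp t * Real.exp (-t) = 1 := by rw [← Real.exp_add]; simp
  have hE' : ((1 / 2 - t) * laguerre n t + 2 * eulerLaguerre n t) ^ 2 / √t +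
      (4 * n + 2 - t + 1 / (4 * t)) * √t * laguerre n t ^ 2 ≤ 100 * √n * Real.exp t := by
    have h := mul_le_mul_of_nonneg_left hE (Real.exp_pos t).le
    rw [laguerreEnergy, ← mul_assoc, hexp, one_mul] at h
    linarith
  have hA : 0 ≤ ((1 / 2 - t) * laguerre n t + 2 * eulerLaguerre n t) ^ 2 / √t := by positivity
  have hB : (n : ℝ) * √t * laguerre n t ^ 2 ≤
      (4 * n + 2 - t + 1 / (4 * t)) * √t * laguerre n t ^ 2 := by gcongr
  have hB0 : 0 ≤ (n : ℝ) * √t * laguerre n t ^ 2 := by positivity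
  constructor
  · refine le_of_mul_le_mul_left ?_ hs
    calc √(n : ℝ) * (√n * √t * laguerre n t ^ 2) = √(n : ℝ) ^ 2 * √t * laguerre n t ^ 2 := by ring
      _ ≤ 100 * √n * Real.exp t := by rw [hsq]; linarith
      _ = _ := by ring
  · have h : ((1 / 2 - t) * laguerre n t + 2 * eulerLaguerre n t) ^ 2 / √t ≤
        100 * √n * Real.exp t := by linarith
    rw [div_le_iff₀ hst] at h
    linarith

lemma sqrt_mul_laguerre_sq_le {n : ℕ} (hn : 1 ≤ n) {t : ℝ} (ht : 0 ≤ t) :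
    √n * √t * laguerre n t ^ 2 ≤ 150 * Real.exp (11 * t / 6) := by
  have hn' : (1 : ℝ) ≤ n := by exact_mod_cast hn
  have h1exp : 1 ≤ Real.exp (11 * t / 6) := Real.one_le_exp (by positivity)
  rcases le_total t (n : ℝ)⁻¹ with h1 | h1
  · have hnt : n * t ≤ 1 := by
      calc (n : ℝ) * t ≤ n * (n : ℝ)⁻¹ := by gcongr
        _ = 1 := mul_inv_cancel₀ (by positivity)
    have hL : laguerre n t ^ 2 ≤ 8 := by
      rw [← sq_abs]
      exact (pow_le_pow_left₀ (abs_nonneg _) (abs_laguerre_le_exp_one n ht hnt) 2).trans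
        exp_one_sq_le
    have hs : √(n : ℝ) * √t ≤ 1 := by
      rw [← Real.sqrt_mul (by positivity)]
      exact Real.sqrt_le_one.2 hnt
    calc _ ≤ 1 * (8 : ℝ) := by gcongr
      _ ≤ _ := by linarith
  rcases le_total t (3 * n) with h2 | h2
  · refine (sqrt_mul_laguerre_sq_le_of_energy hn h1 h2).1.trans ?_
    gcongr
    · norm_num
    · linarith
  · have hL : laguerre n t ^ 2 ≤ Real.exp (5 * t / 6) ^ 2 := by
      rw [← sq_abs]
      exact pow_le_pow_left₀ (abs_nonneg _) (abs_laguerre_le_exp n ht h2) 2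
    have hs : √(n : ℝ) * √t ≤ t := by
      calc √(n : ℝ) * √t ≤ √t * √t := by gcongr; linarith
        _ = t := Real.mul_self_sqrt ht
    have h6 : t ≤ 6 * Real.exp (t / 6) := by linarith [Real.add_one_le_exp (t / 6)]
    calc _ ≤ (6 * Real.exp (t / 6)) * Real.exp (5 * t / 6) ^ 2 := by
          exact mul_le_mul (hs.trans h6) hL (sq_nonneg _) (by positivity)
      _ = 6 * Real.exp (11 * t / 6) := by
          rw [← Real.exp_nat_mul, mul_assoc, ← Real.exp_add]
          ring_nf
      _ ≤ _ := by linarith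

lemma eulerLaguerre_sq_le {n : ℕ} (hn : 1 ≤ n) {t : ℝ} (ht : 0 ≤ t) :
    eulerLaguerre n t ^ 2 ≤ 150 * √n * Real.exp (11 * t / 6) := by
  have hn' : (1 : ℝ) ≤ n := by exact_mod_cast hn
  have h1exp : 1 ≤ Real.exp (11 * t / 6) := Real.one_le_exp (by positivity)
  have hsn : 1 ≤ √(n : ℝ) := Real.one_le_sqrt.2 hn'
  rcases le_total t (n : ℝ)⁻¹ with h1 | h1
  · have hnt : n * t ≤ 1 := by
      calc (n : ℝ) * t ≤ n * (n : ℝ)⁻¹ := by gcongr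
        _ = 1 := mul_inv_cancel₀ (by positivity)
    have hL : eulerLaguerre n t ^ 2 ≤ 8 := by
      rw [← sq_abs]
      exact (pow_le_pow_left₀ (abs_nonneg _) (abs_eulerLaguerre_le_exp_one n ht hnt) 2).trans
        exp_one_sq_le
    nlinarith
  rcases le_total t (3 * n) with h2 | h2
  · obtain ⟨hL, hB⟩ := sqrt_mul_laguerre_sq_le_of_energy hn h1 h2
    have hnt : 1 ≤ √(n : ℝ) * √t := by
      rw [← Real.sqrt_mul (by positivity)]
      refine Real.one_le_sqrt.2 ?_
      calc (1 : ℝ) = n * (n : ℝ)⁻¹ := (mul_inv_cancel₀ (by positivity)).symm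
        _ ≤ n * t := by gcongr
    have hL' : laguerre n t ^ 2 ≤ 100 * √n * Real.exp t := by
      calc laguerre n t ^ 2 ≤ √n * √t * laguerre n t ^ 2 := le_mul_of_one_le_left (sq_nonneg _) hnt
        _ ≤ 100 * 1 * Real.exp t := by linarith
        _ ≤ _ := by gcongr
    have hst : √t ≤ 1 + t := by
      rw [Real.sqrt_le_left (by linarith)]
      nlinarith
    have hquad := Real.quadratic_le_exp_of_nonneg (x := 5 * t / 6) (by positivity)
    set K := 50 * √(n : ℝ) * Real.exp t with hK
    have hK0 : 0 ≤ K := by positivity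
    calc eulerLaguerre n t ^ 2
        ≤ (((1 / 2 - t) * laguerre n t + 2 * eulerLaguerre n t) ^ 2 +
            (1 / 2 - t) ^ 2 * laguerre n t ^ 2) / 2 := by
          nlinarith [sq_nonneg ((1 / 2 - t) * laguerre n t + eulerLaguerre n t)]
      _ ≤ (100 * √n * √t * Real.exp t + (1 / 2 - t) ^ 2 * (100 * √n * Real.exp t)) / 2 := by
          gcongr
      _ = K * (√t + (1 / 2 - t) ^ 2) := by rw [hK]; ring
      _ ≤ K * (3 * Real.exp (5 * t / 6)) := by
          gcongr
          nlinarith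
      _ = 150 * √n * Real.exp (11 * t / 6) := by
          have : Real.exp (11 * t / 6) = Real.exp t * Real.exp (5 * t / 6) := by
            rw [← Real.exp_add]; ring_nf
          rw [hK, this]; ring
  · have hL : eulerLaguerre n t ^ 2 ≤ (n * Real.exp (5 * t / 6)) ^ 2 := by
      rw [← sq_abs]
      exact pow_le_pow_left₀ (abs_nonneg _) (abs_eulerLaguerre_le_exp n ht h2) 2
    have hn3 : (n : ℝ) ≤ t / 3 := by linarith
    have h6 : t ^ 2 ≤ 72 * Real.exp (t / 6) := by
      nlinarith [Real.quadratic_le_exp_of_nonneg (x := t / 6) (by positivity)]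
    calc _ ≤ _ := hL
      _ ≤ (t / 3 * Real.exp (5 * t / 6)) ^ 2 := by gcongr
      _ = t ^ 2 / 9 * Real.exp (5 * t / 6) ^ 2 := by ring
      _ ≤ (72 * Real.exp (t / 6)) / 9 * Real.exp (5 * t / 6) ^ 2 := by gcongr
      _ = 8 * Real.exp (11 * t / 6) := by
          have : Real.exp (11 * t / 6) = Real.exp (t / 6) * Real.exp (5 * t / 6) ^ 2 := by
            rw [← Real.exp_nat_mul, ← Real.exp_add]; ring_nf
          rw [this]; ring
      _ ≤ 150 * √n * Real.exp (11 * t / 6) := by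
          gcongr
          linarith

/-- The Christoffel–Darboux kernel `∑_{n < N} L_n(u) L_n(t)`. -/
noncomputable def laguerreKernel (N : ℕ) (u t : ℝ) : ℝ :=
  ∑ n ∈ range N, laguerre n u * laguerre n t

/-- The numerator of the Christoffel–Darboux formula for `laguerreKernel`. -/
noncomputable def laguerreKernelNum (N : ℕ) (u t : ℝ) : ℝ :=
  laguerre N t * eulerLaguerre N u - laguerre N u * eulerLaguerre N t

lemma sub_mul_laguerreKernel (N : ℕ) (u t : ℝ) :
    (t - u) * laguerreKernel N u t = laguerreKernelNum N u t :=
  sub_mul_sum_laguerre_mul N u t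

lemma continuous_laguerreKernel (N : ℕ) (u : ℝ) : Continuous (laguerreKernel N u) :=
  continuous_finsetSum _ fun n _ => continuous_const.mul (continuous_laguerre n)

lemma continuous_laguerreKernelNum (N : ℕ) (u : ℝ) : Continuous (laguerreKernelNum N u) :=
  ((continuous_laguerre N).mul continuous_const).sub
    (continuous_const.mul (continuous_eulerLaguerre N))

lemma sqrt_mul_laguerre_mul_eulerLaguerre_sq_le {n : ℕ} (hn : 1 ≤ n) {s t : ℝ} (hs : 0 ≤ s)
    (ht : 0 ≤ t) :
    √s * (laguerre n s * eulerLaguerre n t) ^ 2 ≤ 150 ^ 2 * Real.exp (11 * (s + t) / 6) := by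
  have hsn : 0 < √(n : ℝ) := Real.sqrt_pos.2 (by exact_mod_cast hn)
  refine le_of_mul_le_mul_left ?_ hsn
  calc √(n : ℝ) * (√s * (laguerre n s * eulerLaguerre n t) ^ 2)
      = (√n * √s * laguerre n s ^ 2) * eulerLaguerre n t ^ 2 := by ring
    _ ≤ (150 * Real.exp (11 * s / 6)) * (150 * √n * Real.exp (11 * t / 6)) :=
        mul_le_mul (sqrt_mul_laguerre_sq_le hn hs) (eulerLaguerre_sq_le hn ht) (sq_nonneg _)
          (by positivity)
    _ = √n * (150 ^ 2 * Real.exp (11 * (s + t) / 6)) := by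
        have : Real.exp (11 * (s + t) / 6) = Real.exp (11 * s / 6) * Real.exp (11 * t / 6) := by
          rw [← Real.exp_add]; ring_nf
        rw [this]; ring

lemma exists_abs_laguerreKernel_le {u : ℝ} (hu : 0 < u) :
    ∃ A : ℝ, 0 ≤ A ∧ ∀ N : ℕ, ∀ t : ℝ, u + 1 ≤ t →
      |laguerreKernel N u t| ≤ A * Real.exp (11 * t / 12) := by
  have hsu : 0 < √u := Real.sqrt_pos.2 hu
  set B := Real.exp (11 * u / 12) with hB
  refine ⟨150 * B + 150 * B / √(√u), by positivity, fun N t ht => ?_⟩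
  have ht0 : 0 ≤ t := by linarith
  rcases Nat.eq_zero_or_pos N with rfl | hN
  · simp only [laguerreKernel, range_zero, sum_empty, abs_zero]
    positivity
  have hexp (a b : ℝ) : Real.exp (11 * (a + b) / 6) =
      (Real.exp (11 * a / 12) * Real.exp (11 * b / 12)) ^ 2 := by
    rw [← Real.exp_add, ← Real.exp_nat_mul]; push_cast; ring_nf
  have h1 : |laguerre N t * eulerLaguerre N u| ≤ 150 * B * Real.exp (11 * t / 12) := by
    refine abs_le_of_sq_le_sq ?_ (by positivity)
    have hst : 1 ≤ √t := Real.one_le_sqrt.2 (by linarith)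
    calc (laguerre N t * eulerLaguerre N u) ^ 2
        ≤ √t * (laguerre N t * eulerLaguerre N u) ^ 2 := le_mul_of_one_le_left (sq_nonneg _) hst
      _ ≤ 150 ^ 2 * Real.exp (11 * (t + u) / 6) :=
          sqrt_mul_laguerre_mul_eulerLaguerre_sq_le hN ht0 hu.le
      _ = _ := by rw [hexp, hB]; ring
  have h2 : |laguerre N u * eulerLaguerre N t| ≤ 150 * B / √(√u) * Real.exp (11 * t / 12) := by
    refine abs_le_of_sq_le_sq ?_ (by positivity)
    refine le_of_mul_le_mul_left ?_ hsu
    calc √u * (laguerre N u * eulerLaguerre N t) ^ 2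
        ≤ 150 ^ 2 * Real.exp (11 * (u + t) / 6) :=
          sqrt_mul_laguerre_mul_eulerLaguerre_sq_le hN hu.le ht0
      _ = √u * (150 * B / √(√u) * Real.exp (11 * t / 12)) ^ 2 := by
          rw [mul_pow, div_pow, Real.sq_sqrt hsu.le, hexp, hB]
          field_simp
  have h3 : |laguerreKernel N u t| ≤ |laguerreKernelNum N u t| := by
    rw [← sub_mul_laguerreKernel, abs_mul]
    refine le_mul_of_one_le_left (abs_nonneg _) ?_
    rw [le_abs]
    left; linarith
  calc _ ≤ _ := h3
    _ ≤ |laguerre N t * eulerLaguerre N u| + |laguerre N u * eulerLaguerre N t| := abs_sub _ _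
    _ ≤ _ := by linarith

/-- An antiderivative of `t ↦ exp (-t) * laguerreKernelNum (m + 1) u t`, for `m ≠ 0`. -/
noncomputable def laguerreKernelPrimitive (m : ℕ) (u t : ℝ) : ℝ :=
  Real.exp (-t) * (-(eulerLaguerre (m + 1) u * eulerLaguerre (m + 1) t / ((m : ℝ) + 1)) -
    laguerre (m + 1) u * (t * laguerre m t + eulerLaguerre m t / m))

lemma hasDerivAt_exp_neg (t : ℝ) : HasDerivAt (fun t : ℝ => Real.exp (-t)) (-Real.exp (-t)) t := by
  simpa using (hasDerivAt_neg t).exp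

lemma hasDerivAt_laguerreKernelPrimitive {m : ℕ} (hm : m ≠ 0) (u t : ℝ) :
    HasDerivAt (laguerreKernelPrimitive m u)
      (Real.exp (-t) * laguerreKernelNum (m + 1) u t) t := by
  have h := (hasDerivAt_exp_neg t).mul
    ((((hasDerivAt_eulerLaguerre (m + 1) t).const_mul
      (eulerLaguerre (m + 1) u)).div_const ((m : ℝ) + 1)).neg.sub
    (((hasDerivAt_mul_laguerre m t).add
      ((hasDerivAt_eulerLaguerre m t).div_const (m : ℝ))).const_mul (laguerre (m + 1) u)))
  refine h.congr_deriv ?_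
  have hm' : (m : ℝ) ≠ 0 := by exact_mod_cast hm
  have hm1 : (m : ℝ) + 1 ≠ 0 := by positivity
  simp only [Pi.sub_apply, Pi.add_apply, Pi.neg_apply, laguerreKernelNum]
  rw [eulerLaguerre_succ m t]
  push_cast
  field_simp
  ring

lemma exists_abs_laguerreKernelPrimitive_le {u : ℝ} (hu : 0 < u) (b : ℝ) :
    ∃ K : ℝ, 0 ≤ K ∧ ∀ m : ℕ, m ≠ 0 → ∀ t : ℝ, 0 ≤ t → t ≤ b →
      |laguerreKernelPrimitive m u t| ≤ K / √m := by
  have hsu : 0 < √u := Real.sqrt_pos.2 hu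
  set E := Real.exp (11 * u / 6) * Real.exp (11 * b / 6) with hE
  set K1 := 150 ^ 2 * E with hK1
  set K2 := 2 * 150 ^ 2 * E * (√b ^ 3 + 1) / √u with hK2
  refine ⟨√K1 + √K2, by positivity, fun m hm t ht htb => ?_⟩
  have hm1 : 1 ≤ m := Nat.one_le_iff_ne_zero.2 hm
  have hm' : (1 : ℝ) ≤ m := by exact_mod_cast hm1
  have hsm : 1 ≤ √(m : ℝ) := Real.one_le_sqrt.2 hm'
  have hsm2 : √(m : ℝ) ^ 2 = m := Real.sq_sqrt (by positivity)
  have hexp1 : Real.exp (-t) ≤ 1 := Real.exp_le_one_iff.2 (by linarith)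
  have hexpt : Real.exp (11 * t / 6) ≤ Real.exp (11 * b / 6) := by gcongr
  have h1 : |eulerLaguerre (m + 1) u * eulerLaguerre (m + 1) t / ((m : ℝ) + 1)| ≤ √K1 / √m := by
    rw [← Real.sqrt_div (by positivity)]
    refine Real.abs_le_sqrt ?_
    have hp := eulerLaguerre_sq_le (n := m + 1) (by lia) hu.le
    have hq := eulerLaguerre_sq_le (n := m + 1) (by lia) ht
    have hs2 : √((m + 1 : ℕ) : ℝ) ^ 2 = m + 1 := by
      rw [Real.sq_sqrt (by positivity)]; push_cast; rfl
    calc _ = (eulerLaguerre (m + 1) u ^ 2 * eulerLaguerre (m + 1) t ^ 2) / ((m : ℝ) + 1) ^ 2 := by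
          rw [div_pow, mul_pow]
      _ ≤ ((150 * √((m + 1 : ℕ) : ℝ) * Real.exp (11 * u / 6)) *
          (150 * √((m + 1 : ℕ) : ℝ) * Real.exp (11 * b / 6))) / ((m : ℝ) + 1) ^ 2 := by
          gcongr
          exact hq.trans (by gcongr)
      _ = K1 / ((m : ℝ) + 1) := by
          have : (m : ℝ) + 1 ≠ 0 := by positivity
          rw [hK1, hE]
          field_simp
          rw [hs2]
      _ ≤ K1 / m := by
          gcongr
          linarith
  have h2 : |laguerre (m + 1) u * (t * laguerre m t + eulerLaguerre m t / m)| ≤ √K2 / √m := by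
    rw [← Real.sqrt_div (by positivity)]
    refine Real.abs_le_sqrt ?_
    have hp : laguerre (m + 1) u ^ 2 ≤ 150 * Real.exp (11 * u / 6) / (√m * √u) := by
      rw [le_div_iff₀ (by positivity)]
      refine le_trans ?_ (sqrt_mul_laguerre_sq_le (n := m + 1) (by lia) hu.le)
      rw [mul_comm]
      gcongr
      lia
    have hq : √m * (t * laguerre m t) ^ 2 ≤ √b ^ 3 * (150 * Real.exp (11 * b / 6)) := by
      calc √m * (t * laguerre m t) ^ 2 = √t ^ 3 * (√m * √t * laguerre m t ^ 2) := by
            nth_rewrite 1 [← Real.sq_sqrt ht]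
            ring
        _ ≤ √b ^ 3 * (150 * Real.exp (11 * b / 6)) := by
            have h := (sqrt_mul_laguerre_sq_le hm1 ht).trans
              (mul_le_mul_of_nonneg_left hexpt (by norm_num : (0 : ℝ) ≤ 150))
            have ht3 : √t ^ 3 ≤ √b ^ 3 := by gcongr
            exact mul_le_mul ht3 h (by positivity) (by positivity)
    have hr : √m * (eulerLaguerre m t / m) ^ 2 ≤ 150 * Real.exp (11 * b / 6) := by
      calc √m * (eulerLaguerre m t / m) ^ 2
          ≤ √m * ((150 * √m * Real.exp (11 * t / 6)) / m ^ 2) := by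
            rw [div_pow]
            gcongr
            exact eulerLaguerre_sq_le hm1 ht
        _ = 150 * Real.exp (11 * t / 6) / m := by
            field_simp
            rw [hsm2]
        _ ≤ 150 * Real.exp (11 * t / 6) := div_le_self (by positivity) hm'
        _ ≤ _ := by gcongr
    have hs : √m * (t * laguerre m t + eulerLaguerre m t / m) ^ 2 ≤
        2 * (150 * Real.exp (11 * b / 6)) * (√b ^ 3 + 1) := by
      have := mul_le_mul_of_nonneg_left
        (add_sq_le (a := t * laguerre m t) (b := eulerLaguerre m t / m))
        (by positivity : 0 ≤ √(m : ℝ))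
      linarith
    calc _ = laguerre (m + 1) u ^ 2 *
          (√m * (t * laguerre m t + eulerLaguerre m t / m) ^ 2) / √m := by
          field_simp
      _ ≤ (150 * Real.exp (11 * u / 6) / (√m * √u)) *
          (2 * (150 * Real.exp (11 * b / 6)) * (√b ^ 3 + 1)) / √m := by gcongr
      _ = K2 / m := by
          rw [hK2, hE]
          field_simp
          rw [hsm2]
  rw [laguerreKernelPrimitive, abs_mul, abs_of_pos (Real.exp_pos _), add_div]
  refine (mul_le_of_le_one_left (abs_nonneg _) hexp1).trans ((abs_sub _ _).trans ?_)
  rw [abs_neg]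
  exact add_le_add h1 h2

/-- A Riemann–Lebesgue lemma for the Christoffel–Darboux kernel. -/
lemma tendsto_integral_mul_laguerreKernelNum {u : ℝ} (hu : 0 < u) {a b : ℝ} (ha : 0 ≤ a)
    (hab : a ≤ b) {φ φ' : ℝ → ℝ} (hφ : ∀ t ∈ Set.Icc a b, HasDerivAt φ (φ' t) t)
    (hφ' : ContinuousOn φ' (Set.Icc a b)) :
    Tendsto (fun N : ℕ => ∫ t in a..b, φ t * (Real.exp (-t) * laguerreKernelNum N u t))
      atTop (nhds 0) := by
  obtain ⟨K, hK0, hK⟩ := exists_abs_laguerreKernelPrimitive_le hu b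
  obtain ⟨M, hM⟩ := isCompact_Icc.exists_bound_of_continuousOn hφ'
  have hM0 : 0 ≤ M := (norm_nonneg _).trans (hM a (Set.left_mem_Icc.2 hab))
  set D := (|φ b| + |φ a| + M * |b - a|) * K with hD
  rw [← tendsto_add_atTop_iff_nat 1]
  have hlim : Tendsto (fun m : ℕ => D / √m) atTop (nhds 0) :=
    tendsto_const_nhds.div_atTop
      (Real.tendsto_sqrt_atTop.comp tendsto_natCast_atTop_atTop)
  refine squeeze_zero_norm' ?_ hlim
  filter_upwards [eventually_ne_atTop 0] with m hm
  rw [← Set.uIcc_of_le hab] at hφ hφ'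
  have hcont : Continuous fun t => Real.exp (-t) * laguerreKernelNum (m + 1) u t :=
    (Real.continuous_exp.comp continuous_neg).mul (continuous_laguerreKernelNum _ _)
  rw [intervalIntegral.integral_mul_deriv_eq_deriv_mul hφ
    (fun t _ => hasDerivAt_laguerreKernelPrimitive hm u t) hφ'.intervalIntegrable
    (hcont.intervalIntegrable _ _)]
  have hb := hK m hm b (ha.trans hab) le_rfl
  have ha' := hK m hm a ha hab
  have hI : ‖∫ t in a..b, φ' t * laguerreKernelPrimitive m u t‖ ≤ M * (K / √m) * |b - a| := by
    refine intervalIntegral.norm_integral_le_of_norm_le_const fun t ht => ?_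
    rw [Set.uIoc_of_le hab] at ht
    rw [norm_mul]
    exact mul_le_mul (hM t ⟨ht.1.le, ht.2⟩) (hK m hm t (ha.trans ht.1.le) ht.2) (norm_nonneg _) hM0
  refine (norm_sub_le _ _).trans ((add_le_add_left (norm_sub_le _ _) _).trans ?_)
  rw [norm_mul, norm_mul]
  calc _ ≤ |φ b| * (K / √m) + |φ a| * (K / √m) + M * (K / √m) * |b - a| := by
        gcongr
        · exact le_rfl
        · exact hb
        · exact le_rfl
        · exact ha'
    _ = D / √m := by rw [hD]; ring

lemma exists_abs_integral_Ioi_mul_laguerreKernel_le {u : ℝ} (hu : 0 < u) :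
    ∃ A : ℝ, 0 ≤ A ∧ ∀ N : ℕ, ∀ T : ℝ, u + 1 ≤ T → ∀ ψ : ℝ → ℝ, (∀ t, |ψ t| ≤ 1) →
      |∫ t in Set.Ioi T, ψ t * (Real.exp (-t) * laguerreKernel N u t)| ≤
        A * Real.exp (-T / 12) := by
  obtain ⟨A, hA0, hA⟩ := exists_abs_laguerreKernel_le hu
  refine ⟨12 * A, by positivity, fun N T hT ψ hψ => ?_⟩
  have hneg : (-1 / 12 : ℝ) < 0 := by norm_num
  have hg_int := (integrableOn_exp_mul_Ioi hneg T).const_mul A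
  rw [← Real.norm_eq_abs]
  refine (norm_integral_le_of_norm_le hg_int ?_).trans ?_
  · refine (ae_restrict_iff' measurableSet_Ioi).2 (Eventually.of_forall fun t ht => ?_)
    have ht' : T < t := ht
    rw [norm_mul, norm_mul, Real.norm_eq_abs, Real.norm_eq_abs, Real.norm_eq_abs,
      abs_of_pos (Real.exp_pos _)]
    calc |ψ t| * (Real.exp (-t) * |laguerreKernel N u t|)
        ≤ 1 * (Real.exp (-t) * (A * Real.exp (11 * t / 12))) := by
          gcongr
          · exact hψ t
          · exact hA N t (by linarith)
      _ = A * Real.exp (-1 / 12 * t) := by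
          have : Real.exp (-1 / 12 * t) = Real.exp (-t) * Real.exp (11 * t / 12) := by
            rw [← Real.exp_add]; ring_nf
          rw [this]; ring
  · rw [integral_const_mul, integral_exp_mul_Ioi hneg]
    refine le_of_eq ?_
    have : (-1 / 12 * T : ℝ) = -T / 12 := by ring
    rw [this]; ring

/-- The backward differences `L_n - L_{n-1}` of the Laguerre polynomials, with `L_{-1} = 0`. -/
noncomputable def laguerreDiff : ℕ → ℝ → ℝ
  | 0, _ => 1
  | n + 1, v => laguerre (n + 1) v - laguerre n v

lemma laguerreDiff_succ_eq_div (n : ℕ) (v : ℝ) :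
    laguerreDiff (n + 1) v = eulerLaguerre (n + 1) v / ((n : ℝ) + 1) := by
  rw [laguerreDiff, laguerre_succ]
  ring

lemma hasDerivAt_laguerreDiff (n : ℕ) (v : ℝ) :
    HasDerivAt (laguerreDiff n) (laguerreDiff n v - laguerre n v) v := by
  cases n with
  | zero =>
    have h0 : laguerreDiff 0 = fun _ => 1 := rfl
    rw [h0, laguerre_zero]
    simpa using hasDerivAt_const v (1 : ℝ)
  | succ n =>
    have h0 : laguerreDiff (n + 1) = fun v => eulerLaguerre (n + 1) v / ((n : ℝ) + 1) :=
      funext (laguerreDiff_succ_eq_div n)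
    have hne : (n : ℝ) + 1 ≠ 0 := by positivity
    rw [h0]
    refine ((hasDerivAt_eulerLaguerre (n + 1) v).div_const _).congr_deriv ?_
    push_cast
    field_simp

lemma laguerreDiff_apply_zero (n : ℕ) : laguerreDiff n 0 = if n = 0 then 1 else 0 := by
  cases n with
  | zero => rfl
  | succ n => simp [laguerreDiff, laguerre_apply_zero]

lemma tendsto_exp_neg_mul_laguerreDiff (n : ℕ) :
    Tendsto (fun v => Real.exp (-v) * laguerreDiff n v) atTop (nhds 0) := by
  have hL (n : ℕ) : Tendsto (fun v => Real.exp (-v) * laguerre n v) atTop (nhds 0) := by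
    have h : Tendsto (fun v => ∑ k ∈ range (n + 1),
        ((n.choose k : ℝ) * (-1 : ℝ) ^ k / (Nat.factorial k : ℝ)) * (v ^ k * Real.exp (-v)))
        atTop (nhds (∑ k ∈ range (n + 1),
          ((n.choose k : ℝ) * (-1 : ℝ) ^ k / (Nat.factorial k : ℝ)) * 0)) :=
      tendsto_finsetSum _ fun k _ =>
        (Real.tendsto_pow_mul_exp_neg_atTop_nhds_zero k).const_mul _
    simp only [mul_zero, sum_const_zero] at h
    refine h.congr fun v => ?_
    rw [laguerre, mul_sum]
    exact sum_congr rfl fun k _ => by ring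
  cases n with
  | zero => simpa [laguerreDiff, laguerre_zero] using hL 0
  | succ n => simpa [laguerreDiff, mul_sub] using (hL (n + 1)).sub (hL n)

/-- The integral of `exp (-t) * laguerreKernel N u t` over `t ∈ (v, ∞)`, in closed form. -/
noncomputable def laguerreKernelTail (N : ℕ) (u v : ℝ) : ℝ :=
  Real.exp (-v) * ∑ n ∈ range N, laguerre n u * laguerreDiff n v

lemma hasDerivAt_laguerreKernelTail (N : ℕ) (u v : ℝ) :
    HasDerivAt (laguerreKernelTail N u) (-(Real.exp (-v) * laguerreKernel N u v)) v := by
  have h := (hasDerivAt_exp_neg v).mul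
    (HasDerivAt.fun_sum (u := range N) fun n _ =>
      (hasDerivAt_laguerreDiff n v).const_mul (laguerre n u))
  refine h.congr_deriv ?_
  simp only [laguerreKernel, mul_sub, sum_sub_distrib]
  ring

lemma continuous_exp_neg_mul_laguerreKernel (N : ℕ) (u : ℝ) :
    Continuous fun t => Real.exp (-t) * laguerreKernel N u t :=
  (Real.continuous_exp.comp continuous_neg).mul (continuous_laguerreKernel N u)

lemma integral_exp_neg_mul_laguerreKernel (N : ℕ) (u a b : ℝ) :
    ∫ t in a..b, Real.exp (-t) * laguerreKernel N u t =
      laguerreKernelTail N u a - laguerreKernelTail N u b := by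
  rw [intervalIntegral.integral_eq_sub_of_hasDerivAt
    (f := fun t => -laguerreKernelTail N u t)
    (fun t _ => (hasDerivAt_laguerreKernelTail N u t).neg.congr_deriv (neg_neg _))
    ((continuous_exp_neg_mul_laguerreKernel N u).intervalIntegrable _ _)]
  ring

lemma integrableOn_exp_neg_mul_laguerreKernel (N : ℕ) {u : ℝ} (hu : 0 < u) (a : ℝ) :
    IntegrableOn (fun t => Real.exp (-t) * laguerreKernel N u t) (Set.Ioi a) := by
  obtain ⟨A, hA0, hA⟩ := exists_abs_laguerreKernel_le hu
  refine integrable_of_isBigO_exp_neg (b := 1 / 12) (by norm_num)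
    (continuous_exp_neg_mul_laguerreKernel N u).continuousOn ?_
  refine Asymptotics.IsBigO.of_bound A ?_
  filter_upwards [eventually_ge_atTop (u + 1)] with t ht
  rw [norm_mul, Real.norm_eq_abs, Real.norm_eq_abs, Real.norm_eq_abs, Real.abs_exp, Real.abs_exp]
  calc Real.exp (-t) * |laguerreKernel N u t|
      ≤ Real.exp (-t) * (A * Real.exp (11 * t / 12)) := by
        gcongr
        exact hA N t ht
    _ = A * Real.exp (-(1 / 12) * t) := by
        have : Real.exp (-(1 / 12) * t) = Real.exp (-t) * Real.exp (11 * t / 12) := by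
          rw [← Real.exp_add]; ring_nf
        rw [this]; ring

lemma integral_Ioi_exp_neg_mul_laguerreKernel (N : ℕ) {u : ℝ} (hu : 0 < u) (a : ℝ) :
    ∫ t in Set.Ioi a, Real.exp (-t) * laguerreKernel N u t = laguerreKernelTail N u a := by
  have hlim : Tendsto (fun t => -laguerreKernelTail N u t) atTop (nhds 0) := by
    have h : Tendsto (fun v => ∑ n ∈ range N, laguerre n u * (Real.exp (-v) * laguerreDiff n v))
        atTop (nhds (∑ n ∈ range N, laguerre n u * 0)) :=
      tendsto_finsetSum _ fun n _ => (tendsto_exp_neg_mul_laguerreDiff n).const_mul _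
    simp only [mul_zero, sum_const_zero] at h
    have h' := h.neg
    rw [neg_zero] at h'
    refine h'.congr fun v => ?_
    rw [laguerreKernelTail, mul_sum]
    exact congrArg Neg.neg (sum_congr rfl fun n _ => by ring)
  rw [integral_Ioi_of_hasDerivAt_of_tendsto
    (hasDerivAt_laguerreKernelTail N u a).neg.continuousAt.continuousWithinAt
    (fun t _ => (hasDerivAt_laguerreKernelTail N u t).neg.congr_deriv (neg_neg _))
    (integrableOn_exp_neg_mul_laguerreKernel N hu a) hlim]
  simp

lemma laguerreKernelTail_apply_zero {N : ℕ} (hN : N ≠ 0) (u : ℝ) :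
    laguerreKernelTail N u 0 = 1 := by
  simp [laguerreKernelTail, laguerreDiff_apply_zero, laguerre_zero, Nat.pos_of_ne_zero hN]

lemma tendsto_laguerreKernelTail_sub {u a b : ℝ} (hu : 0 < u) (ha : 0 ≤ a) (hab : a ≤ b)
    (hne : ∀ t ∈ Set.Icc a b, t ≠ u) :
    Tendsto (fun N => laguerreKernelTail N u a - laguerreKernelTail N u b) atTop (nhds 0) := by
  have hne' : ∀ t ∈ Set.Icc a b, t - u ≠ 0 := fun t ht => sub_ne_zero.2 (hne t ht)
  have h := tendsto_integral_mul_laguerreKernelNum hu ha hab (φ := fun t => (t - u)⁻¹)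
    (φ' := fun t => -1 / (t - u) ^ 2)
    (fun t ht => ((hasDerivAt_id t).sub_const u).fun_inv (hne' t ht))
    (continuousOn_const.div (by fun_prop) fun t ht => pow_ne_zero 2 (hne' t ht))
  refine h.congr fun N => ?_
  rw [← integral_exp_neg_mul_laguerreKernel]
  refine intervalIntegral.integral_congr fun t ht => ?_
  rw [Set.uIcc_of_le hab] at ht
  have := hne' t ht
  simp only [← sub_mul_laguerreKernel]
  field_simp

lemma tendsto_laguerreKernelTail_of_lt {u v : ℝ} (hv : 0 ≤ v) (huv : v < u) :
    Tendsto (fun N => laguerreKernelTail N u v) atTop (nhds 1) := by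
  have h := (tendsto_laguerreKernelTail_sub (hv.trans_lt huv) le_rfl hv
    (fun t ht => (ht.2.trans_lt huv).ne)).const_sub 1
  rw [sub_zero] at h
  refine h.congr' ?_
  filter_upwards [eventually_ne_atTop 0] with N hN
  rw [laguerreKernelTail_apply_zero hN]
  ring

lemma tendsto_laguerreKernelTail_of_gt {u v : ℝ} (hu : 0 < u) (huv : u < v) :
    Tendsto (fun N => laguerreKernelTail N u v) atTop (nhds 0) := by
  obtain ⟨A, -, hA⟩ := exists_abs_integral_Ioi_mul_laguerreKernel_le hu
  have hexp : Tendsto (fun T : ℝ => A * Real.exp (-T / 12)) atTop (nhds 0) := by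
    have : Tendsto (fun T : ℝ => -T / 12) atTop atBot :=
      tendsto_neg_atTop_atBot.atBot_div_const (by norm_num)
    simpa using (Real.tendsto_exp_atBot.comp this).const_mul A
  rw [Metric.tendsto_nhds]
  intro ε hε
  obtain ⟨T, hT1, hT2, hT3⟩ := ((hexp.eventually (gt_mem_nhds (half_pos hε))).and
    ((eventually_ge_atTop (u + 1)).and (eventually_ge_atTop v))).exists
  have h := tendsto_laguerreKernelTail_sub hu (hu.trans huv).le hT3
    (fun t ht => (huv.trans_le ht.1).ne')
  filter_upwards [Metric.tendsto_nhds.1 h (ε / 2) (half_pos hε)] with N hN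
  have h1 := hA N T hT2 (fun _ => 1) (fun _ => by simp)
  simp only [one_mul, integral_Ioi_exp_neg_mul_laguerreKernel N hu] at h1
  rw [Real.dist_eq, sub_zero] at hN ⊢
  have h2 := abs_add_le (laguerreKernelTail N u v - laguerreKernelTail N u T)
    (laguerreKernelTail N u T)
  rw [sub_add_cancel] at h2
  linarith

lemma hasDerivAt_exp_neg_mul_sum_laguerreDiff_sq (m : ℕ) (v : ℝ) :
    HasDerivAt (fun v => Real.exp (-v) * ∑ n ∈ range (m + 1), laguerreDiff n v ^ 2)
      (-(Real.exp (-v) * laguerre m v ^ 2)) v := by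
  have hsum (m : ℕ) : -∑ n ∈ range (m + 1), laguerreDiff n v ^ 2 +
      ∑ n ∈ range (m + 1), 2 * laguerreDiff n v ^ 1 * (laguerreDiff n v - laguerre n v) =
      -laguerre m v ^ 2 := by
    induction m with
    | zero => simp [laguerreDiff, laguerre_zero]
    | succ m ih =>
      rw [sum_range_succ _ (m + 1), sum_range_succ _ (m + 1), laguerreDiff]
      linear_combination ih
  have h := (hasDerivAt_exp_neg v).mul
    (HasDerivAt.fun_sum (u := range (m + 1)) fun n _ => (hasDerivAt_laguerreDiff n v).fun_pow 2)
  refine h.congr_deriv ?_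
  have := hsum m
  push_cast
  linear_combination Real.exp (-v) * this

lemma laguerreKernelTail_self (m : ℕ) (u : ℝ) :
    laguerreKernelTail (m + 1) u u = Real.exp (-u) * laguerre m u ^ 2 / 2 +
      Real.exp (-u) * (∑ n ∈ range (m + 1), laguerreDiff n u ^ 2) / 2 := by
  have h : ∑ n ∈ range (m + 1), laguerre n u * laguerreDiff n u =
      (laguerre m u ^ 2 + ∑ n ∈ range (m + 1), laguerreDiff n u ^ 2) / 2 := by
    induction m with
    | zero => simp [laguerreDiff, laguerre_zero]
    | succ m ih =>
      rw [sum_range_succ, ih, sum_range_succ _ (m + 1), laguerreDiff]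
      ring
  rw [laguerreKernelTail, h]
  ring

lemma tendsto_sqrt_natCast_atTop : Tendsto (fun m : ℕ => √(m : ℝ)) atTop atTop :=
  Real.tendsto_sqrt_atTop.comp tendsto_natCast_atTop_atTop

lemma tendsto_integral_exp_neg_mul_laguerre_sq {u : ℝ} (hu : 0 < u) :
    Tendsto (fun m : ℕ => ∫ t in (0 : ℝ)..u, Real.exp (-t) * laguerre m t ^ 2) atTop (nhds 0) := by
  have hg_int : IntervalIntegrable (fun t : ℝ => t ^ (-1 / 2 : ℝ)) volume 0 u :=
    intervalIntegral.intervalIntegrable_rpow' (by norm_num)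
  set I := ∫ t in (0 : ℝ)..u, t ^ (-1 / 2 : ℝ)
  refine squeeze_zero_norm' (a := fun m : ℕ => (150 * Real.exp (11 * u / 6) * I) / √m) ?_
    (tendsto_const_nhds.div_atTop tendsto_sqrt_natCast_atTop)
  filter_upwards [eventually_ge_atTop 1] with m hm
  have hsm : 0 < √(m : ℝ) := Real.sqrt_pos.2 (by exact_mod_cast hm)
  refine (intervalIntegral.norm_integral_le_of_norm_le hu.le
    (g := fun t => (150 * Real.exp (11 * u / 6) / √m) * t ^ (-1 / 2 : ℝ))
    (Eventually.of_forall fun t ht => ?_) (hg_int.const_mul _)).trans_eq ?_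
  · have hst : 0 < √t := Real.sqrt_pos.2 ht.1
    have hpow : t ^ (-1 / 2 : ℝ) = (√t)⁻¹ := by
      rw [Real.sqrt_eq_rpow, ← Real.rpow_neg ht.1.le]; norm_num
    rw [Real.norm_eq_abs, abs_of_nonneg (by positivity), hpow, ← div_eq_mul_inv, div_div,
      le_div_iff₀ (by positivity)]
    calc _ = Real.exp (-t) * (√m * √t * laguerre m t ^ 2) := by ring
      _ ≤ 1 * (150 * Real.exp (11 * t / 6)) := by
          refine mul_le_mul (Real.exp_le_one_iff.2 (by linarith [ht.1]))
            (sqrt_mul_laguerre_sq_le hm ht.1.le) (by positivity) zero_le_one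
      _ ≤ 150 * Real.exp (11 * u / 6) := by
          rw [one_mul]
          gcongr
          exact ht.2
  · rw [intervalIntegral.integral_const_mul]
    ring

lemma tendsto_laguerreKernelTail_self {u : ℝ} (hu : 0 < u) :
    Tendsto (fun N => laguerreKernelTail N u u) atTop (nhds (1 / 2)) := by
  rw [← tendsto_add_atTop_iff_nat 1]
  have hsq : Tendsto (fun m : ℕ => laguerre m u ^ 2) atTop (nhds 0) := by
    have hsu : 0 < √u := Real.sqrt_pos.2 hu
    refine squeeze_zero' (g := fun m : ℕ => (150 * Real.exp (11 * u / 6) / √u) / √m)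
      (Eventually.of_forall fun m => sq_nonneg _) ?_
      (tendsto_const_nhds.div_atTop tendsto_sqrt_natCast_atTop)
    filter_upwards [eventually_ge_atTop 1] with m hm
    have hsm : 0 < √(m : ℝ) := Real.sqrt_pos.2 (by exact_mod_cast hm)
    rw [div_div, le_div_iff₀ (by positivity)]
    linarith [sqrt_mul_laguerre_sq_le hm hu.le]
  have hS (m : ℕ) : Real.exp (-u) * ∑ n ∈ range (m + 1), laguerreDiff n u ^ 2 =
      1 - ∫ t in (0 : ℝ)..u, Real.exp (-t) * laguerre m t ^ 2 := by
    have hc : Continuous fun t => -(Real.exp (-t) * laguerre m t ^ 2) :=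
      ((Real.continuous_exp.comp continuous_neg).mul ((continuous_laguerre m).pow 2)).neg
    have h := intervalIntegral.integral_eq_sub_of_hasDerivAt
      (fun t _ => hasDerivAt_exp_neg_mul_sum_laguerreDiff_sq m t) (hc.intervalIntegrable 0 u)
    rw [intervalIntegral.integral_neg] at h
    simp only [laguerreDiff_apply_zero] at h
    simp at h
    linarith
  have h := ((hsq.const_mul (Real.exp (-u) / 2)).add
    (((tendsto_integral_exp_neg_mul_laguerre_sq hu).const_sub 1).div_const 2))
  rw [mul_zero, zero_add, sub_zero] at h
  refine h.congr fun m => ?_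
  rw [laguerreKernelTail_self, hS]
  ring

lemma exists_exp_eq_add_sub_mul (u : ℝ) :
    ∃ φ φ' : ℝ → ℝ, Continuous φ' ∧ (∀ t, HasDerivAt φ (φ' t) t) ∧
      ∀ t, Real.exp t = Real.exp u + (t - u) * φ t := by
  set g : ℂ → ℂ := dslope Complex.exp (u : ℂ)
  have hg : Differentiable ℂ g := by
    rw [← differentiableOn_univ, Complex.differentiableOn_dslope Filter.univ_mem]
    exact Complex.differentiable_exp.differentiableOn
  have hg' : Continuous (deriv g) := (hg.contDiff (n := 1)).continuous_deriv le_rfl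
  refine ⟨fun t => (g t).re, fun t => (deriv g t).re,
    Complex.continuous_re.comp (hg'.comp Complex.continuous_ofReal),
    fun t => (hg (t : ℂ)).hasDerivAt.real_of_complex, fun t => ?_⟩
  have h := congrArg Complex.re (sub_smul_dslope Complex.exp (u : ℂ) (t : ℂ))
  rw [smul_eq_mul, ← Complex.ofReal_sub, Complex.re_ofReal_mul, Complex.sub_re,
    Complex.exp_ofReal_re, Complex.exp_ofReal_re] at h
  simp only [g]
  linarith

lemma tendsto_integral_laguerreKernel {u T : ℝ} (hu : 0 < u) (hT : u < T) :
    Tendsto (fun N => ∫ t in (0 : ℝ)..T, laguerreKernel N u t) atTop (nhds (Real.exp u)) := by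
  obtain ⟨φ, φ', hφ', hφ, hexp⟩ := exists_exp_eq_add_sub_mul u
  have hφc : Continuous φ := continuous_iff_continuousAt.2 fun t => (hφ t).continuousAt
  have h1 := tendsto_integral_mul_laguerreKernelNum hu le_rfl (hu.trans hT).le
    (fun t _ => hφ t) hφ'.continuousOn
  have h2 := ((tendsto_laguerreKernelTail_of_lt le_rfl hu).sub
    (tendsto_laguerreKernelTail_of_gt hu hT)).const_mul (Real.exp u)
  have h3 := h2.add h1
  rw [sub_zero, mul_one, add_zero] at h3
  refine h3.congr fun N => ?_
  rw [← integral_exp_neg_mul_laguerreKernel, ← intervalIntegral.integral_const_mul,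
    ← intervalIntegral.integral_add]
  · refine intervalIntegral.integral_congr fun t _ => ?_
    simp only [← sub_mul_laguerreKernel]
    have he : Real.exp t * Real.exp (-t) = 1 := by rw [← Real.exp_add]; simp
    rw [hexp t] at he
    linear_combination laguerreKernel N u t * he
  · exact ((continuous_exp_neg_mul_laguerreKernel N u).const_mul _).intervalIntegrable _ _
  · exact (hφc.mul ((Real.continuous_exp.comp continuous_neg).mul
      (continuous_laguerreKernelNum N u))).intervalIntegrable _ _

lemma measurable_fract_exp : Measurable fun t : ℝ => Int.fract (Real.exp t) :=
  Real.measurable_exp.fract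

lemma abs_fract_le_one (y : ℝ) : |Int.fract y| ≤ 1 := by
  rw [Int.abs_fract]
  exact (Int.fract_lt_one y).le

lemma Continuous.intervalIntegrable_fract_exp_mul {g : ℝ → ℝ} (hg : Continuous g) (a b : ℝ) :
    IntervalIntegrable (fun t => Int.fract (Real.exp t) * g t) volume a b :=
  ⟨(hg.intervalIntegrable a b).1.bdd_mul measurable_fract_exp.aestronglyMeasurable
      (Eventually.of_forall fun _ => abs_fract_le_one _),
    (hg.intervalIntegrable a b).2.bdd_mul measurable_fract_exp.aestronglyMeasurable
      (Eventually.of_forall fun _ => abs_fract_le_one _)⟩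

lemma integral_log_fract_exp_mul {k : ℕ} (hk : 1 ≤ k) (g : ℝ → ℝ) :
    ∫ t in Real.log k..Real.log (k + 1 : ℕ), Int.fract (Real.exp t) * g t =
      ∫ t in Real.log k..Real.log (k + 1 : ℕ), (Real.exp t - k) * g t := by
  have hk0 : (0 : ℝ) < k := by exact_mod_cast hk
  have hle : Real.log k ≤ Real.log (k + 1 : ℕ) := Real.log_le_log hk0 (by push_cast; linarith)
  rw [intervalIntegral.integral_of_le hle, intervalIntegral.integral_of_le hle,
    ← integral_Ico_eq_integral_Ioc, ← integral_Ico_eq_integral_Ioc]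
  refine setIntegral_congr_fun measurableSet_Ico fun t ht => ?_
  have h1 : (k : ℝ) ≤ Real.exp t := (Real.log_le_iff_le_exp hk0).1 ht.1
  have h2 : Real.exp t < k + 1 := by
    have := (Real.lt_log_iff_exp_lt (by positivity)).1 ht.2
    exact_mod_cast this
  have hfl : ⌊Real.exp t⌋ = (k : ℤ) :=
    Int.floor_eq_iff.2 ⟨by exact_mod_cast h1, by exact_mod_cast h2⟩
  simp only [Int.fract, hfl, Int.cast_natCast]

lemma integral_zero_log_fract_exp_mul_laguerreKernel (N : ℕ) (u : ℝ) {M : ℕ} (hM : 1 ≤ M) :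
    ∫ t in (0 : ℝ)..Real.log M, Int.fract (Real.exp t) * (Real.exp (-t) * laguerreKernel N u t) =
      (∫ t in (0 : ℝ)..Real.log M, laguerreKernel N u t) - ∑ k ∈ Ico 1 M,
        (k : ℝ) * (laguerreKernelTail N u (Real.log k) -
          laguerreKernelTail N u (Real.log (k + 1 : ℕ))) := by
  have hc := continuous_exp_neg_mul_laguerreKernel N u
  induction M, hM using Nat.le_induction with
  | base => simp
  | succ k hk ih =>
    rw [← intervalIntegral.integral_add_adjacent_intervals
        (hc.intervalIntegrable_fract_exp_mul 0 (Real.log k))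
        (hc.intervalIntegrable_fract_exp_mul _ _), ih, integral_log_fract_exp_mul hk,
      sum_Ico_succ_top hk, ← integral_exp_neg_mul_laguerreKernel,
      ← intervalIntegral.integral_add_adjacent_intervals
        ((continuous_laguerreKernel N u).intervalIntegrable 0 (Real.log k))
        ((continuous_laguerreKernel N u).intervalIntegrable (Real.log k) (Real.log (k + 1 : ℕ))),
      ← intervalIntegral.integral_const_mul]
    have : ∫ t in Real.log k..Real.log (k + 1 : ℕ),
        (Real.exp t - k) * (Real.exp (-t) * laguerreKernel N u t) =
        (∫ t in Real.log k..Real.log (k + 1 : ℕ), laguerreKernel N u t) -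
        ∫ t in Real.log k..Real.log (k + 1 : ℕ),
          (k : ℝ) * (Real.exp (-t) * laguerreKernel N u t) := by
      rw [← intervalIntegral.integral_sub
        ((continuous_laguerreKernel N u).intervalIntegrable _ _)
        ((hc.const_mul _).intervalIntegrable _ _)]
      refine intervalIntegral.integral_congr fun t _ => ?_
      have he : Real.exp t * Real.exp (-t) = 1 := by rw [← Real.exp_add]; simp
      linear_combination laguerreKernel N u t * he
    rw [this]
    ring

/-- The pointwise limit of `laguerreKernelTail N (log x) (log k)` as `N → ∞`. -/
noncomputable def normalizedStep (x : ℝ) (k : ℕ) : ℝ :=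
  if (k : ℝ) < x then 1 else if (k : ℝ) = x then 1 / 2 else 0

lemma tendsto_laguerreKernelTail_log {x : ℝ} (hx : 1 < x) {k : ℕ} (hk : 1 ≤ k) :
    Tendsto (fun N => laguerreKernelTail N (Real.log x) (Real.log k)) atTop
      (nhds (normalizedStep x k)) := by
  have hk0 : (0 : ℝ) < k := by exact_mod_cast hk
  rw [normalizedStep]
  split_ifs with h1 h2
  · exact tendsto_laguerreKernelTail_of_lt (Real.log_natCast_nonneg k) (Real.log_lt_log hk0 h1)
  · rw [h2]
    exact tendsto_laguerreKernelTail_self (Real.log_pos hx)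
  · exact tendsto_laguerreKernelTail_of_gt (Real.log_pos hx)
      (Real.log_lt_log (by linarith) (lt_of_le_of_ne (not_lt.1 h1) (Ne.symm h2)))

lemma sum_mul_normalizedStep_sub (x : ℝ) {M : ℕ} (hM : 1 ≤ M) :
    ∑ k ∈ Ico 1 M, (k : ℝ) * (normalizedStep x k - normalizedStep x (k + 1)) =
      ∑ k ∈ Ico 1 M, normalizedStep x k - ((M : ℝ) - 1) * normalizedStep x M := by
  induction M, hM using Nat.le_induction with
  | base => simp
  | succ k hk ih =>
    rw [sum_Ico_succ_top hk, ih, sum_Ico_succ_top hk]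
    push_cast
    ring

lemma sub_sum_normalizedStep {x : ℝ} (hx : 1 < x) {M : ℕ} (hM : x < M) :
    x - ∑ k ∈ Ico 1 M, normalizedStep x k =
      if ∃ k : ℤ, x = (k : ℝ) then (1 / 2 : ℝ) else Int.fract x := by
  have hx0 : 0 ≤ x := by linarith
  have hfM : ⌊x⌋₊ < M := (Nat.floor_lt hx0).2 hM
  have hf1 : 1 ≤ ⌊x⌋₊ := Nat.le_floor (by exact_mod_cast hx.le)
  have hzero : ∀ k ∈ Ico (⌊x⌋₊ + 1) M, normalizedStep x k = 0 := fun k hk => by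
    have : x < k := Nat.lt_of_floor_lt (mem_Ico.1 hk).1
    rw [normalizedStep, if_neg this.not_gt, if_neg this.ne']
  have hone : ∀ k ∈ Ico 1 ⌊x⌋₊, normalizedStep x k = 1 := fun k hk => by
    have h1 : (k : ℝ) < ⌊x⌋₊ := by exact_mod_cast (mem_Ico.1 hk).2
    rw [normalizedStep, if_pos (h1.trans_le (Nat.floor_le hx0))]
  rw [← sum_Ico_consecutive _ (Nat.le_succ_of_le hf1) hfM, sum_eq_zero hzero,
    sum_Ico_succ_top hf1, sum_congr rfl hone, sum_const, Nat.card_Ico, nsmul_eq_mul, mul_one,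
    Nat.cast_sub hf1, Nat.cast_one]
  split_ifs with h
  · obtain ⟨k, rfl⟩ := h
    have hk : ((⌊(k : ℝ)⌋₊ : ℕ) : ℝ) = k := by
      rw [natCast_floor_eq_intCast_floor hx0, Int.floor_intCast]
    rw [normalizedStep, hk, if_neg (lt_irrefl _), if_pos rfl]
    ring
  · have hne : ((⌊x⌋₊ : ℕ) : ℝ) ≠ x := fun h' => h ⟨⌊x⌋₊, by exact_mod_cast h'.symm⟩
    rw [normalizedStep, if_pos (lt_of_le_of_ne (Nat.floor_le hx0) hne), Int.fract,
      natCast_floor_eq_intCast_floor hx0]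
    ring

lemma tendsto_integral_zero_log_fract_exp_mul_laguerreKernel {x : ℝ} (hx : 1 < x) {M : ℕ}
    (hM : x < M) :
    Tendsto (fun N => ∫ t in (0 : ℝ)..Real.log M,
        Int.fract (Real.exp t) * (Real.exp (-t) * laguerreKernel N (Real.log x) t)) atTop
      (nhds (if ∃ k : ℤ, x = (k : ℝ) then (1 / 2 : ℝ) else Int.fract x)) := by
  have hM1 : 1 ≤ M := by exact_mod_cast (hx.trans hM).le
  have h1 := tendsto_integral_laguerreKernel (Real.log_pos hx)
    (Real.log_lt_log (by linarith) hM)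
  rw [Real.exp_log (by linarith)] at h1
  have h2 : Tendsto (fun N => ∑ k ∈ Ico 1 M, (k : ℝ) *
      (laguerreKernelTail N (Real.log x) (Real.log k) -
        laguerreKernelTail N (Real.log x) (Real.log (k + 1 : ℕ)))) atTop
      (nhds (∑ k ∈ Ico 1 M, (k : ℝ) * (normalizedStep x k - normalizedStep x (k + 1)))) :=
    tendsto_finsetSum _ fun k hk => ((tendsto_laguerreKernelTail_log hx (mem_Ico.1 hk).1).sub
      (tendsto_laguerreKernelTail_log hx (Nat.le_add_left 1 k))).const_mul _
  have h0 : normalizedStep x M = 0 := by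
    rw [normalizedStep, if_neg hM.not_gt, if_neg hM.ne']
  have h3 := h1.sub h2
  rw [sum_mul_normalizedStep_sub x hM1, h0, mul_zero, sub_zero, sub_sum_normalizedStep hx hM] at h3
  exact h3.congr fun N => (integral_zero_log_fract_exp_mul_laguerreKernel N _ hM1).symm

lemma tendsto_integral_Ioi_fract_exp_mul_laguerreKernel {x : ℝ} (hx : 1 < x) :
    Tendsto (fun N => ∫ t in Set.Ioi 0,
        Int.fract (Real.exp t) * (Real.exp (-t) * laguerreKernel N (Real.log x) t)) atTop
      (nhds (if ∃ k : ℤ, x = (k : ℝ) then (1 / 2 : ℝ) else Int.fract x)) := by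
  set F : ℕ → ℝ → ℝ := fun N t =>
    Int.fract (Real.exp t) * (Real.exp (-t) * laguerreKernel N (Real.log x) t)
  have hu := Real.log_pos hx
  obtain ⟨A, -, hA⟩ := exists_abs_integral_Ioi_mul_laguerreKernel_le hu
  have hlog : Tendsto (fun M : ℕ => Real.log M) atTop atTop :=
    Real.tendsto_log_atTop.comp tendsto_natCast_atTop_atTop
  have hexp : Tendsto (fun M : ℕ => A * Real.exp (-Real.log M / 12)) atTop (nhds 0) := by
    have : Tendsto (fun M : ℕ => -Real.log M / 12) atTop atBot :=
      (tendsto_neg_atTop_atBot.comp hlog).atBot_div_const (by norm_num)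
    simpa using (Real.tendsto_exp_atBot.comp this).const_mul A
  have hF (N : ℕ) (a : ℝ) : IntegrableOn (F N) (Set.Ioi a) :=
    (integrableOn_exp_neg_mul_laguerreKernel N hu a).bdd_mul (c := 1)
      measurable_fract_exp.aestronglyMeasurable
      (Eventually.of_forall fun _ => abs_fract_le_one _)
  rw [Metric.tendsto_nhds]
  intro ε hε
  obtain ⟨M, hM1, hM2, hM3⟩ := ((hexp.eventually (gt_mem_nhds (half_pos hε))).and
    ((hlog.eventually (eventually_ge_atTop (Real.log x + 1))).and
      (tendsto_natCast_atTop_atTop.eventually (eventually_gt_atTop x)))).exists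
  filter_upwards [Metric.tendsto_nhds.1
    (tendsto_integral_zero_log_fract_exp_mul_laguerreKernel hx hM3) (ε / 2) (half_pos hε)]
    with N hN
  have h1 := hA N _ hM2 (fun t => Int.fract (Real.exp t)) (fun _ => abs_fract_le_one _)
  have h2 := intervalIntegral.integral_interval_add_Ioi (hF N 0) (hF N (Real.log M))
  simp only [F] at h2
  rw [← h2]
  rw [Real.dist_eq] at hN ⊢
  rw [abs_lt] at hN ⊢
  have h1' := abs_le.1 h1
  constructor <;> linarith [h1'.1, h1'.2, hN.1, hN.2]

lemma integrableOn_pow_mul_exp_neg (k : ℕ) :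
    IntegrableOn (fun t : ℝ => t ^ k * Real.exp (-t)) (Set.Ioi 0) := by
  have h := Real.GammaIntegral_convergent (s := (k : ℝ) + 1) (by positivity)
  refine h.congr_fun (fun t _ => ?_) measurableSet_Ioi
  simp only [add_sub_cancel_right, Real.rpow_natCast]
  ring

lemma integrableOn_fract_exp_mul_pow (k : ℕ) :
    IntegrableOn (fun t : ℝ => Int.fract (Real.exp t) * (t ^ k * Real.exp (-t))) (Set.Ioi 0) :=
  (integrableOn_pow_mul_exp_neg k).bdd_mul (c := 1) measurable_fract_exp.aestronglyMeasurable
    (Eventually.of_forall fun _ => abs_fract_le_one _)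

/-- The moments of the measure `{exp t} * exp (-t) dt` on `(0, ∞)`. -/
noncomputable def fractMoment (k : ℕ) : ℝ :=
  ∫ t in Set.Ioi 0, Int.fract (Real.exp t) * (t ^ k * Real.exp (-t))

lemma integral_exp_sub_mul_deriv_pow_mul_exp_neg (n : ℕ) {k : ℕ} (hk : 1 ≤ k) :
    ∫ t in Real.log k..Real.log (k + 1 : ℕ), (Real.exp t - k) *
        ((n : ℝ) * (t ^ (n - 1) * Real.exp (-t)) - t ^ n * Real.exp (-t)) =
      Real.log (k + 1 : ℕ) ^ n / (k + 1 : ℕ) -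
        (Real.log (k + 1 : ℕ) ^ (n + 1) - Real.log k ^ (n + 1)) / ((n : ℝ) + 1) := by
  have hk0 : (0 : ℝ) < k := by exact_mod_cast hk
  have hk1 : (0 : ℝ) < (k + 1 : ℕ) := by positivity
  have hderiv (t : ℝ) : HasDerivAt
      (fun t => (Real.exp t - k) * (t ^ n * Real.exp (-t)) - t ^ (n + 1) / ((n : ℝ) + 1))
      ((Real.exp t - k) *
        ((n : ℝ) * (t ^ (n - 1) * Real.exp (-t)) - t ^ n * Real.exp (-t))) t := by
    refine ((((Real.hasDerivAt_exp t).sub_const (k : ℝ)).fun_mul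
      ((hasDerivAt_pow n t).fun_mul (hasDerivAt_exp_neg t))).fun_sub
      ((hasDerivAt_pow (n + 1) t).div_const ((n : ℝ) + 1))).congr_deriv ?_
    have he : Real.exp t * Real.exp (-t) = 1 := by rw [← Real.exp_add]; simp
    have hn : (n : ℝ) + 1 ≠ 0 := by positivity
    have hq : ((n + 1 : ℕ) : ℝ) * t ^ (n + 1 - 1) / ((n : ℝ) + 1) = t ^ n := by
      rw [Nat.add_sub_cancel]
      push_cast
      field_simp
    rw [hq]
    linear_combination t ^ n * he
  rw [intervalIntegral.integral_eq_sub_of_hasDerivAt (fun t _ => hderiv t)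
    (Continuous.intervalIntegrable (by fun_prop) _ _), Real.exp_log hk0, Real.exp_log hk1,
    Real.exp_neg, Real.exp_log hk1]
  push_cast
  ring

lemma integral_fract_exp_mul_deriv_pow_mul_exp_neg (n : ℕ) {N : ℕ} (hN : 1 ≤ N) :
    ∫ t in (0 : ℝ)..Real.log N, Int.fract (Real.exp t) *
        ((n : ℝ) * (t ^ (n - 1) * Real.exp (-t)) - t ^ n * Real.exp (-t)) =
      (∑ k ∈ range N, Real.log ((k : ℝ) + 1) ^ n / ((k : ℝ) + 1)) -
        Real.log N ^ (n + 1) / ((n : ℝ) + 1) - 0 ^ n := by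
  have hc : Continuous fun t : ℝ =>
    (n : ℝ) * (t ^ (n - 1) * Real.exp (-t)) - t ^ n * Real.exp (-t) := by fun_prop
  induction N, hN using Nat.le_induction with
  | base => simp
  | succ k hk ih =>
    rw [← intervalIntegral.integral_add_adjacent_intervals
        (hc.intervalIntegrable_fract_exp_mul 0 (Real.log k))
        (hc.intervalIntegrable_fract_exp_mul _ _), ih, integral_log_fract_exp_mul hk,
      integral_exp_sub_mul_deriv_pow_mul_exp_neg n hk, sum_range_succ]
    push_cast
    ring

lemma stieltjes_eq (n : ℕ) :
    stieltjes n = 0 ^ n + (n * fractMoment (n - 1) - fractMoment n) := by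
  have h1 := (integrableOn_fract_exp_mul_pow (n - 1)).const_mul (n : ℝ)
  have h2 := integrableOn_fract_exp_mul_pow n
  have h12 : ∀ t : ℝ, (n : ℝ) * (Int.fract (Real.exp t) * (t ^ (n - 1) * Real.exp (-t))) -
      Int.fract (Real.exp t) * (t ^ n * Real.exp (-t)) = Int.fract (Real.exp t) *
        ((n : ℝ) * (t ^ (n - 1) * Real.exp (-t)) - t ^ n * Real.exp (-t)) := fun t => by ring
  have h3 := h1.sub h2
  have h4 := intervalIntegral_tendsto_integral_Ioi 0 h3
    (Real.tendsto_log_atTop.comp tendsto_natCast_atTop_atTop)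
  simp only [Pi.sub_apply, h12] at h4
  have h5 : ∫ t in Set.Ioi 0, Int.fract (Real.exp t) *
      ((n : ℝ) * (t ^ (n - 1) * Real.exp (-t)) - t ^ n * Real.exp (-t)) =
      n * fractMoment (n - 1) - fractMoment n := by
    simp only [← h12]
    rw [integral_sub h1 h2, integral_const_mul]
    rfl
  rw [h5] at h4
  refine ((h4.const_add (0 ^ n)).congr' ?_).limUnder_eq
  filter_upwards [eventually_ge_atTop 1] with N hN
  rw [Function.comp_apply, integral_fract_exp_mul_deriv_pow_mul_exp_neg n hN]
  ring

lemma sum_choose_mul_sub (a : ℕ → ℝ) (p : ℕ) :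
    ∑ j ∈ range (p + 1), (p.choose j : ℝ) * (-1) ^ j * (a j - a (j + 1)) =
      ∑ j ∈ range (p + 2), ((p + 1).choose j : ℝ) * (-1) ^ j * a j := by
  have h : ∑ j ∈ range (p + 1), (p.choose j : ℝ) * (-1) ^ j * a j =
      ∑ j ∈ range (p + 1), (p.choose (j + 1) : ℝ) * (-1) ^ (j + 1) * a (j + 1) + a 0 := by
    have h1 := sum_range_succ (fun j => (p.choose j : ℝ) * (-1) ^ j * a j) (p + 1)
    have h2 := sum_range_succ' (fun j => (p.choose j : ℝ) * (-1) ^ j * a j) (p + 1)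
    simp only [Nat.choose_succ_self, Nat.choose_zero_right, Nat.cast_zero, zero_mul, add_zero,
      Nat.cast_one, pow_zero, one_mul] at h1 h2
    rw [← h1, h2]
  rw [sum_range_succ' _ (p + 1)]
  simp only [mul_sub, sum_sub_distrib, h, Nat.choose_succ_succ, Nat.cast_add, add_mul,
    sum_add_distrib, Nat.choose_zero_right, Nat.cast_one, pow_zero, one_mul, pow_succ, mul_neg,
    mul_one, neg_mul, sum_neg_distrib]
  ring

lemma neg_one_pow_mul_ellSeq_eq_sum (n : ℕ) :
    (-1 : ℝ) ^ (n + 1) * ellSeq n = ∑ j ∈ range (n + 1),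
      (n.choose j : ℝ) * (-1) ^ j * (fractMoment j / (Nat.factorial j : ℝ)) := by
  cases n with
  | zero => simp [ellSeq, stieltjes_eq]
  | succ p =>
    rw [← sum_choose_mul_sub, ellSeq, if_neg p.succ_ne_zero, ← Ico_add_one_right_eq_Icc,
      sum_Ico_eq_sum_range, mul_sum]
    refine sum_congr rfl fun j hj => ?_
    have hjp : j ≤ p := Nat.lt_succ_iff.1 (mem_range.1 hj)
    rw [stieltjes_eq]
    obtain ⟨q, rfl⟩ := Nat.exists_eq_add_of_le hjp
    have h1 : j + q + 1 - (1 + j) = q := by omega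
    have h2 : 1 + j - 1 = j := by omega
    have h3 : (-1 : ℝ) ^ (j + q + 1 + 1) * (-1) ^ q = (-1) ^ j := by
      rw [← pow_add, show j + q + 1 + 1 + q = j + 2 * (q + 1) by ring, pow_add, pow_mul]
      simp
    have hf : (Nat.factorial j : ℝ) ≠ 0 := by positivity
    have hj1 : (j : ℝ) + 1 ≠ 0 := by positivity
    rw [h1, h2, Nat.add_sub_cancel, add_comm 1 j, zero_pow j.succ_ne_zero, Nat.factorial_succ,
      ← h3]
    push_cast
    field_simp
    ring

lemma integral_fract_exp_mul_laguerre (n : ℕ) :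
    IntegrableOn (fun t => Int.fract (Real.exp t) * (Real.exp (-t) * laguerre n t)) (Set.Ioi 0) ∧
    ∫ t in Set.Ioi 0, Int.fract (Real.exp t) * (Real.exp (-t) * laguerre n t) =
      (-1 : ℝ) ^ (n + 1) * ellSeq n := by
  have hsum (t : ℝ) : Int.fract (Real.exp t) * (Real.exp (-t) * laguerre n t) =
      ∑ j ∈ range (n + 1), ((n.choose j : ℝ) * (-1) ^ j / (Nat.factorial j : ℝ)) *
        (Int.fract (Real.exp t) * (t ^ j * Real.exp (-t))) := by
    rw [laguerre, mul_sum, mul_sum]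
    exact sum_congr rfl fun j _ => by ring
  have hg_int : ∀ j ∈ range (n + 1), IntegrableOn (fun t : ℝ =>
      ((n.choose j : ℝ) * (-1) ^ j / (Nat.factorial j : ℝ)) *
        (Int.fract (Real.exp t) * (t ^ j * Real.exp (-t)))) (Set.Ioi 0) :=
    fun j _ => (integrableOn_fract_exp_mul_pow j).const_mul _
  simp only [hsum]
  refine ⟨integrable_finsetSum _ hg_int, ?_⟩
  rw [integral_finsetSum _ hg_int, neg_one_pow_mul_ellSeq_eq_sum]
  refine sum_congr rfl fun j _ => ?_
  rw [integral_const_mul, fractMoment]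
  ring

lemma sum_ellSeq_mul_laguerre (N : ℕ) (u : ℝ) :
    ∑ n ∈ range N, (-1 : ℝ) ^ (n + 1) * ellSeq n * laguerre n u =
      ∫ t in Set.Ioi 0, Int.fract (Real.exp t) * (Real.exp (-t) * laguerreKernel N u t) := by
  have hsum (t : ℝ) : Int.fract (Real.exp t) * (Real.exp (-t) * laguerreKernel N u t) =
      ∑ n ∈ range N, laguerre n u *
        (Int.fract (Real.exp t) * (Real.exp (-t) * laguerre n t)) := by
    rw [laguerreKernel, mul_sum, mul_sum]
    exact sum_congr rfl fun n _ => by ring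
  simp only [hsum]
  rw [integral_finsetSum _ fun n _ => (integral_fract_exp_mul_laguerre n).1.const_mul _]
  refine sum_congr rfl fun n _ => ?_
  rw [integral_const_mul, (integral_fract_exp_mul_laguerre n).2]
  ring

theorem statement4 (x : ℝ) (hx : 1 < x) :
    Tendsto (fun N : ℕ =>
        ∑ n ∈ Finset.range N, (-1 : ℝ) ^ (n + 1) * ellSeq n * laguerre n (Real.log x))
      atTop
      (nhds (if ∃ k : ℤ, x = (k : ℝ) then (1 / 2 : ℝ) else Int.fract x)) := by
  simp only [sum_ellSeq_mul_laguerre]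
  exact tendsto_integral_Ioi_fract_exp_mul_laguerreKernel hx
end

section
/- ∫_{1}^{∞} {x}² / x² dx = log(2π) − γ_0 − 1, where γ_0 is the Euler–Mascheroni constant and {x} = x − ⌊x⌋ is the fractional part. -/
open Filter Finset MeasureTheory

lemma stieltjes_zero_eq_eulerMascheroniConstant :
    stieltjes 0 = Real.eulerMascheroniConstant := by
  refine Tendsto.limUnder_eq (Real.tendsto_harmonic_sub_log.congr fun N => ?_)
  simp [harmonic]

lemma integrableOn_fract_sq_div_sq :
    IntegrableOn (fun x : ℝ => Int.fract x ^ 2 / x ^ 2) (Set.Ioi 1) := by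
  refine Integrable.mono' (integrableOn_Ioi_rpow_of_lt (a := -2) (c := 1) (by norm_num) one_pos)
    ?_ ?_
  · exact ((measurable_fract.pow_const 2).div (measurable_id.pow_const 2)).aestronglyMeasurable
  · refine (ae_restrict_iff' measurableSet_Ioi).2 (Eventually.of_forall fun x hx => ?_)
    have hx0 : (0 : ℝ) < x := one_pos.trans hx
    rw [Real.norm_of_nonneg (by positivity), Real.rpow_neg hx0.le, Real.rpow_two, ← one_div]
    gcongr
    exact pow_le_one₀ (Int.fract_nonneg x) (Int.fract_lt_one x).le

lemma intervalIntegrable_fract_sq_div_sq {a b : ℝ} (ha : 1 ≤ a) (hb : 1 ≤ b) :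
    IntervalIntegrable (fun x : ℝ => Int.fract x ^ 2 / x ^ 2) volume a b :=
  intervalIntegrable_iff.2 <| integrableOn_fract_sq_div_sq.mono_set fun _ hx =>
    (le_min ha hb).trans_lt hx.1

lemma integral_fract_sq_div_sq_unit (n : ℕ) :
    ∫ x in ((n : ℝ) + 1)..((n : ℝ) + 1 + 1), Int.fract x ^ 2 / x ^ 2 =
      2 - 1 / ((n : ℝ) + 2) -
        2 * ((n : ℝ) + 1) * (Real.log ((n : ℝ) + 2) - Real.log ((n : ℝ) + 1)) := by
  have hn : (0 : ℝ) ≤ n := n.cast_nonneg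
  have hderiv : ∀ x : ℝ, 0 < x → HasDerivAt
      (fun x : ℝ => x - 2 * ((n : ℝ) + 1) * Real.log x - ((n : ℝ) + 1) ^ 2 * x⁻¹)
      (1 - 2 * ((n : ℝ) + 1) * x⁻¹ - ((n : ℝ) + 1) ^ 2 * (-(x ^ 2)⁻¹)) x := fun x hx =>
    ((hasDerivAt_id' x).sub ((Real.hasDerivAt_log hx.ne').const_mul _)).sub
      ((hasDerivAt_inv hx.ne').const_mul _)
  rw [intervalIntegral.integral_eq_sub_of_hasDerivAt_of_le (by linarith)
    (fun x hx => (hderiv x (by linarith [hx.1])).continuousAt.continuousWithinAt) ?_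
    (intervalIntegrable_fract_sq_div_sq (by linarith) (by linarith))]
  · rw [show (n : ℝ) + 1 + 1 = n + 2 by ring]
    field_simp
    ring
  · intro x hx
    have hx0 : 0 < x := by linarith [hx.1]
    have hfloor : ⌊x⌋ = (n : ℤ) + 1 := by
      rw [Int.floor_eq_iff]
      push_cast
      exact ⟨hx.1.le, hx.2⟩
    refine (hderiv x hx0).congr_deriv ?_
    rw [← Int.self_sub_floor, hfloor]
    push_cast
    field_simp
    ring

lemma integral_fract_sq_div_sq_one_natCast (n : ℕ) :
    ∫ x in (1 : ℝ)..((n : ℝ) + 1), Int.fract x ^ 2 / x ^ 2 =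
      2 * ((n : ℝ) + 1) - 1 - harmonic (n + 1) - 2 * ((n : ℝ) + 1) * Real.log ((n : ℝ) + 1) +
        2 * Real.log ((n + 1).factorial : ℝ) := by
  induction n with
  | zero => norm_num [harmonic]
  | succ n ih =>
    have hn : (0 : ℝ) ≤ n := n.cast_nonneg
    have hfac : Real.log ((n + 1 + 1).factorial : ℝ) =
        Real.log ((n : ℝ) + 2) + Real.log ((n + 1).factorial : ℝ) := by
      rw [Nat.factorial_succ (n + 1), Nat.cast_mul, Real.log_mul (by positivity) (by positivity)]
      push_cast
      ring_nf
    rw [harmonic_succ (n + 1), hfac]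
    push_cast
    rw [← intervalIntegral.integral_add_adjacent_intervals
      (intervalIntegrable_fract_sq_div_sq le_rfl (by linarith : (1 : ℝ) ≤ n + 1))
      (intervalIntegrable_fract_sq_div_sq (by linarith) (by linarith)), ih,
      integral_fract_sq_div_sq_unit, show (n : ℝ) + 1 + 1 = n + 2 by ring]
    ring

lemma integral_fract_sq_div_sq_eq_log_stirlingSeq (n : ℕ) :
    ∫ x in (1 : ℝ)..((n : ℝ) + 1), Int.fract x ^ 2 / x ^ 2 =
      2 * Real.log (Stirling.stirlingSeq (n + 1)) + Real.log 2 -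
        (harmonic (n + 1) - Real.log ((n + 1 : ℕ) : ℝ)) - 1 := by
  have hn : (n : ℝ) + 1 ≠ 0 := by positivity
  rw [integral_fract_sq_div_sq_one_natCast, Stirling.log_stirlingSeq_formula]
  push_cast
  rw [Real.log_mul two_ne_zero hn, Real.log_div hn (Real.exp_ne_zero 1), Real.log_exp]
  ring

theorem statement6 :
    ∫ x in Set.Ioi (1 : ℝ), Int.fract x ^ 2 / x ^ 2 =
      Real.log (2 * Real.pi) - stieltjes 0 - 1 := by
  have hlim := intervalIntegral_tendsto_integral_Ioi 1 integrableOn_fract_sq_div_sq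
    (tendsto_natCast_atTop_atTop.atTop_add (tendsto_const_nhds (x := (1 : ℝ))))
  refine tendsto_nhds_unique (hlim.congr integral_fract_sq_div_sq_eq_log_stirlingSeq) ?_
  have hstirling := (Stirling.tendsto_stirlingSeq_sqrt_pi.log
    (Real.sqrt_pos.2 Real.pi_pos).ne').comp (tendsto_add_atTop_nat 1)
  have hharmonic := Real.tendsto_harmonic_sub_log.comp (tendsto_add_atTop_nat 1)
  have hvalue : Real.log (2 * Real.pi) - stieltjes 0 - 1 =
      2 * Real.log √Real.pi + Real.log 2 - Real.eulerMascheroniConstant - 1 := by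
    rw [stieltjes_zero_eq_eulerMascheroniConstant, Real.log_sqrt Real.pi_pos.le,
      Real.log_mul two_ne_zero Real.pi_ne_zero]
    ring
  rw [hvalue]
  exact (((hstirling.const_mul 2).add_const (Real.log 2)).sub hharmonic).sub_const 1
end

section
/- For every nonnegative integer m, (1/m!) ∫_{1}^{∞} ({x}² − {x}) (log x)^m / x² dx = (−1)^{m−1} + 2 ∑_{k=0}^{m+1} (−1)^k ζ^{(k)}(0) / k!, where ζ^{(k)}(0) is the k-th derivative of the Riemann zeta function at 0. -/
open Filter Finset MeasureTheory Asymptotics Topology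

/-- The function `({t}² - {t}) (log t)ⁿ` on `(1, ∞)`, extended by zero. -/
noncomputable def fractSqLogPow (n : ℕ) : ℝ → ℂ :=
  (Set.Ioi 1).indicator fun t ↦ (((Int.fract t ^ 2 - Int.fract t) * Real.log t ^ n : ℝ) : ℂ)

lemma abs_fract_sq_sub_fract_le_one (t : ℝ) : |Int.fract t ^ 2 - Int.fract t| ≤ 1 := by
  have h0 := Int.fract_nonneg t
  have h1 := Int.fract_lt_one t
  rw [abs_le]
  constructor <;> nlinarith

lemma log_smul_fractSqLogPow (n : ℕ) :
    (fun t : ℝ ↦ Real.log t • fractSqLogPow n t) = fractSqLogPow (n + 1) := by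
  ext t
  by_cases ht : t ∈ Set.Ioi (1 : ℝ)
  · simp [fractSqLogPow, ht, pow_succ]
    ring
  · simp [fractSqLogPow, ht]

lemma measurable_fractSqLogPow (n : ℕ) : Measurable (fractSqLogPow n) := by
  refine Measurable.indicator ?_ measurableSet_Ioi
  fun_prop

lemma norm_fractSqLogPow_le (n : ℕ) (t : ℝ) : ‖fractSqLogPow n t‖ ≤ ‖Real.log t ^ n‖ := by
  refine (norm_indicator_le_norm_self _ _).trans ?_
  rw [Complex.norm_real, norm_mul]
  exact mul_le_of_le_one_left (norm_nonneg _) (abs_fract_sq_sub_fract_le_one t)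

lemma locallyIntegrableOn_fractSqLogPow (n : ℕ) :
    LocallyIntegrableOn (fractSqLogPow n) (Set.Ioi 0) := by
  have h : LocallyIntegrableOn (fun t : ℝ ↦ Real.log t ^ n) (Set.Ioi 0) := by
    refine ContinuousOn.locallyIntegrableOn ?_ measurableSet_Ioi
    exact (Real.continuousOn_log.mono (by simp)).pow n
  exact h.mono (measurable_fractSqLogPow n).aestronglyMeasurable
    (.of_forall (norm_fractSqLogPow_le n))

lemma isBigO_fractSqLogPow_atTop (n : ℕ) {a : ℝ} (ha : a < 0) :
    fractSqLogPow n =O[atTop] (· ^ (-a) : ℝ → ℝ) := by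
  refine (isBigO_of_le _ (norm_fractSqLogPow_le n)).trans ?_
  simpa using (isLittleO_log_rpow_rpow_atTop (n : ℝ) (neg_pos.2 ha)).isBigO

lemma isBigO_fractSqLogPow_zero (n : ℕ) (b : ℝ) :
    fractSqLogPow n =O[𝓝[>] 0] (· ^ (-b) : ℝ → ℝ) := by
  have h : fractSqLogPow n =ᶠ[𝓝[>] 0] 0 := by
    filter_upwards [Ioo_mem_nhdsGT (zero_lt_one (α := ℝ))] with t ht
    simp [fractSqLogPow, ht.2.le]
  exact h.trans_isBigO (isBigO_zero _ _)

lemma hasDerivAt_mellin_fractSqLogPow (n : ℕ) {s : ℂ} (hs : s.re < 0) :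
    MellinConvergent (fractSqLogPow n) s ∧
      HasDerivAt (mellin (fractSqLogPow n)) (mellin (fractSqLogPow (n + 1)) s) s := by
  obtain ⟨a, hsa, ha⟩ := exists_between hs
  have hb : s.re - 1 < s.re := by linarith
  refine ⟨mellinConvergent_of_isBigO_rpow (locallyIntegrableOn_fractSqLogPow n)
    (isBigO_fractSqLogPow_atTop n ha) hsa (isBigO_fractSqLogPow_zero n _) hb, ?_⟩
  rw [← log_smul_fractSqLogPow]
  exact (mellin_hasDerivAt_of_isBigO_rpow (locallyIntegrableOn_fractSqLogPow n)
    (isBigO_fractSqLogPow_atTop n ha) hsa (isBigO_fractSqLogPow_zero n _) hb).2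

/-- The integral `∫ t in (1, ∞), ({t}² - {t}) t ^ (-s - 2)`. -/
noncomputable def fractSqIntegral (s : ℂ) : ℂ := mellin (fractSqLogPow 0) (-s - 1)

lemma iteratedDeriv_fractSqIntegral (n : ℕ) {s : ℂ} (hs : -1 < s.re) :
    iteratedDeriv n fractSqIntegral s = (-1) ^ n * mellin (fractSqLogPow n) (-s - 1) := by
  induction n generalizing s with
  | zero => simp [fractSqIntegral]
  | succ n ih =>
    have h : iteratedDeriv n fractSqIntegral =ᶠ[𝓝 s]
        fun z ↦ (-1) ^ n * mellin (fractSqLogPow n) (-z - 1) := by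
      filter_upwards [(isOpen_lt continuous_const Complex.continuous_re).mem_nhds hs] with z hz
      exact ih hz
    have hd := (hasDerivAt_mellin_fractSqLogPow n (s := -s - 1) (by simp; linarith)).2
    have hd' := (hd.comp s ((hasDerivAt_id s).neg.sub_const 1)).const_mul ((-1 : ℂ) ^ n)
    rw [iteratedDeriv_succ, h.deriv_eq]
    refine hd'.deriv.trans ?_
    rw [pow_succ]
    ring

lemma differentiableOn_fractSqIntegral : DifferentiableOn ℂ fractSqIntegral {s | -1 < s.re} := by
  intro s hs
  have hs' : -1 < s.re := hs
  have hd := (hasDerivAt_mellin_fractSqLogPow 0 (s := -s - 1) (by simp; linarith)).2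
  exact (hd.comp s ((hasDerivAt_id s).neg.sub_const 1)).differentiableAt.differentiableWithinAt

lemma mellin_fractSqLogPow (n : ℕ) (s : ℂ) :
    mellin (fractSqLogPow n) s = ∫ t in Set.Ioi (1 : ℝ),
      (((Int.fract t ^ 2 - Int.fract t) * Real.log t ^ n : ℝ) : ℂ) * (t : ℂ) ^ (s - 1) := by
  have h : (fun t : ℝ ↦ (t : ℂ) ^ (s - 1) • fractSqLogPow n t) = (Set.Ioi 1).indicator fun t ↦
      (((Int.fract t ^ 2 - Int.fract t) * Real.log t ^ n : ℝ) : ℂ) * (t : ℂ) ^ (s - 1) := by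
    ext t
    by_cases ht : t ∈ Set.Ioi (1 : ℝ)
    · simp only [fractSqLogPow, Set.indicator_of_mem ht, smul_eq_mul]
      ring
    · simp [fractSqLogPow, ht]
  rw [mellin, h, setIntegral_indicator measurableSet_Ioi]
  congr 2
  ext t
  simp only [Set.mem_inter_iff, Set.mem_Ioi]
  exact ⟨And.right, fun h ↦ ⟨zero_lt_one.trans h, h⟩⟩

lemma mellin_fractSqLogPow_neg_one (n : ℕ) :
    mellin (fractSqLogPow n) (-1) = ((∫ x in Set.Ioi (1 : ℝ),
      (Int.fract x ^ 2 - Int.fract x) * Real.log x ^ n / x ^ 2 : ℝ) : ℂ) := by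
  rw [mellin_fractSqLogPow, ← integral_complex_ofReal]
  refine integral_congr_ae (.of_forall fun t ↦ ?_)
  have : (-1 - 1 : ℂ) = ((-2 : ℤ) : ℂ) := by norm_num
  simp only [this, Complex.cpow_intCast]
  push_cast
  simp only [zpow_neg, div_eq_mul_inv]
  norm_cast
lemma continuous_fract_sq_sub_fract : Continuous fun t : ℝ ↦ Int.fract t ^ 2 - Int.fract t :=
  ContinuousOn.comp_fract'' (f := fun x : ℝ ↦ x ^ 2 - x) (by fun_prop) (by norm_num)

lemma hasDerivWithinAt_fract_Ioi (t : ℝ) : HasDerivWithinAt (Int.fract : ℝ → ℝ) 1 (Set.Ioi t) t := by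
  have h : HasDerivWithinAt (fun x : ℝ ↦ x - ⌊t⌋) 1 (Set.Ioi t) t :=
    ((hasDerivAt_id t).sub_const _).hasDerivWithinAt
  refine h.congr_of_eventuallyEq ?_ rfl
  filter_upwards [Ioo_mem_nhdsGT (Int.lt_floor_add_one t)] with x hx
  rw [Int.fract, Int.floor_eq_on_Ico ⌊t⌋ x ⟨(Int.floor_le t).trans hx.1.le, hx.2⟩]

/-- An antiderivative of `⌊t⌋ t ^ (-s - 1) + (s + 1) / 2 * ({t}² - {t}) t ^ (-s - 2)`. -/
noncomputable def floorPrimitive (s : ℂ) (t : ℝ) : ℂ :=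
  (t : ℂ) ^ (1 - s) / (1 - s) + (t : ℂ) ^ (-s) / (2 * s)
    - ((Int.fract t ^ 2 - Int.fract t : ℝ) : ℂ) / 2 * (t : ℂ) ^ (-s - 1)

lemma hasDerivWithinAt_floorPrimitive {s : ℂ} (hs : 1 < s.re) {t : ℝ} (ht : 0 < t) :
    HasDerivWithinAt (floorPrimitive s) ((⌊t⌋ : ℂ) * (t : ℂ) ^ (-(s + 1)) +
      (s + 1) / 2 * (((Int.fract t ^ 2 - Int.fract t : ℝ) : ℂ) * (t : ℂ) ^ (-s - 2)))
      (Set.Ioi t) t := by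
  have h1 : 1 - s ≠ 0 := fun h ↦ by simp [← sub_eq_zero.1 h] at hs
  have h0 : s ≠ 0 := fun h ↦ by norm_num [h] at hs
  have h2 : -s - 1 ≠ 0 := fun h ↦ by
    have := congrArg Complex.re h
    simp at this
    linarith
  have hB := (((hasDerivWithinAt_fract_Ioi t).pow 2).sub (hasDerivWithinAt_fract_Ioi t)).ofReal_comp
  have hA := (((hasDerivAt_ofReal_cpow_const ht.ne' h1).div_const (1 - s)).add
    ((hasDerivAt_ofReal_cpow_const ht.ne' (neg_ne_zero.2 h0)).div_const (2 * s))).hasDerivWithinAt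
      (s := Set.Ioi t)
  have h := hA.sub ((hB.div_const 2).mul
    (hasDerivAt_ofReal_cpow_const ht.ne' h2).hasDerivWithinAt)
  refine h.congr_deriv ?_
  have hfl : (⌊t⌋ : ℂ) = t - (Int.fract t : ℝ) := by
    rw [← Complex.ofReal_sub, Int.self_sub_fract, Complex.ofReal_intCast]
  have e1 : (t : ℂ) ^ (1 - s - 1) = t * (t : ℂ) ^ (-(s + 1)) := by
    rw [show 1 - s - 1 = -(s + 1) + 1 by ring,
      Complex.cpow_add _ _ (by exact_mod_cast ht.ne'), Complex.cpow_one, mul_comm]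
  have e2 : -s - 1 = -(s + 1) := by ring
  have e3 : -s - 1 - 1 = -s - 2 := by ring
  rw [hfl, e1, e3, e2]
  simp only [Pi.sub_apply, Pi.pow_apply]
  push_cast
  field_simp
  ring

lemma continuousOn_floorPrimitive (s : ℂ) : ContinuousOn (floorPrimitive s) (Set.Ioi 0) := by
  have h (r : ℂ) : ContinuousOn (fun t : ℝ ↦ (t : ℂ) ^ r) (Set.Ioi 0) := fun t ht ↦
    (Complex.continuousAt_ofReal_cpow_const _ _ (.inr (ne_of_gt ht))).continuousWithinAt
  have hB := (Complex.continuous_ofReal.comp continuous_fract_sq_sub_fract).continuousOn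
    (s := Set.Ioi 0)
  exact (((h _).div_const _).add ((h _).div_const _)).sub ((hB.div_const 2).mul (h _))

lemma tendsto_floorPrimitive_atTop {s : ℂ} (hs : 1 < s.re) :
    Tendsto (floorPrimitive s) atTop (𝓝 0) := by
  have h {r : ℂ} (hr : r.re < 0) : Tendsto (fun t : ℝ ↦ (t : ℂ) ^ r) atTop (𝓝 0) := by
    rw [tendsto_zero_iff_norm_tendsto_zero]
    refine Tendsto.congr' ?_ (tendsto_rpow_neg_atTop (neg_pos.2 hr))
    filter_upwards [eventually_gt_atTop 0] with t ht
    rw [Complex.norm_cpow_eq_rpow_re_of_pos ht, neg_neg]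
  have h1 := (h (r := 1 - s) (by simpa using hs)).div_const (1 - s)
  have h2 := (h (r := -s) (by simp; linarith)).div_const (2 * s)
  have h3 : Tendsto (fun t : ℝ ↦ ((Int.fract t ^ 2 - Int.fract t : ℝ) : ℂ) / 2 *
      (t : ℂ) ^ (-s - 1)) atTop (𝓝 0) := by
    refine squeeze_zero_norm (fun t ↦ ?_)
      (tendsto_zero_iff_norm_tendsto_zero.1 (h (r := -s - 1) (by simp; linarith)))
    rw [norm_mul, norm_div, Complex.norm_real]
    refine mul_le_of_le_one_left (norm_nonneg _) ?_
    have := abs_fract_sq_sub_fract_le_one t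
    rw [Real.norm_eq_abs, Complex.norm_ofNat]
    linarith
  have h4 := (h1.add h2).sub h3
  rwa [zero_div, zero_div, add_zero, sub_zero] at h4

lemma integrableOn_fract_sq_mul_cpow {s : ℂ} (hs : -1 < s.re) :
    IntegrableOn (fun t : ℝ ↦ ((Int.fract t ^ 2 - Int.fract t : ℝ) : ℂ) * (t : ℂ) ^ (-s - 2))
      (Set.Ioi 1) := by
  have h : IntegrableOn (fun t : ℝ ↦ (t : ℂ) ^ (-s - 2)) (Set.Ioi 1) :=
    integrableOn_Ioi_cpow_of_lt (by simp; linarith) one_pos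
  refine h.bdd_mul (c := 1) ?_ (.of_forall fun t ↦ ?_)
  · exact (Complex.continuous_ofReal.comp continuous_fract_sq_sub_fract).aestronglyMeasurable
  · rw [Complex.norm_real]
    exact abs_fract_sq_sub_fract_le_one t

lemma fractSqIntegral_eq (s : ℂ) : fractSqIntegral s = ∫ t in Set.Ioi (1 : ℝ),
    ((Int.fract t ^ 2 - Int.fract t : ℝ) : ℂ) * (t : ℂ) ^ (-s - 2) := by
  rw [fractSqIntegral, mellin_fractSqLogPow, show -s - 1 - 1 = -s - 2 by ring]
  simp only [pow_zero, mul_one]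

lemma integrableOn_floor_mul_cpow {s : ℂ} (hs : 1 < s.re) :
    IntegrableOn (fun t : ℝ ↦ (⌊t⌋ : ℂ) * (t : ℂ) ^ (-(s + 1))) (Set.Ioi 1) := by
  have h : IntegrableOn (fun t : ℝ ↦ (t : ℂ) ^ (-s)) (Set.Ioi 1) :=
    integrableOn_Ioi_cpow_of_lt (by simpa using hs) one_pos
  refine h.integrable.mono (Measurable.aestronglyMeasurable (by fun_prop)) ?_
  filter_upwards [ae_restrict_mem measurableSet_Ioi] with t (ht : 1 < t)
  have ht0 : 0 < t := zero_lt_one.trans ht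
  rw [show -s = 1 + -(s + 1) by ring, Complex.cpow_add _ _ (by exact_mod_cast ht0.ne'),
    Complex.cpow_one, norm_mul, norm_mul, Complex.norm_of_nonneg ht0.le, Complex.norm_intCast,
    abs_of_nonneg (by exact_mod_cast Int.floor_nonneg.2 ht0.le)]
  gcongr
  exact Int.floor_le t

lemma integral_floor_add_fractSqIntegral {s : ℂ} (hs : 1 < s.re) :
    (∫ t in Set.Ioi (1 : ℝ), (⌊t⌋ : ℂ) * (t : ℂ) ^ (-(s + 1))) + (s + 1) / 2 * fractSqIntegral s =
      1 / (s - 1) - 1 / (2 * s) := by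
  have hi1 := integrableOn_floor_mul_cpow hs
  have hi2 := (integrableOn_fract_sq_mul_cpow (s := s) (by linarith)).const_mul ((s + 1) / 2)
  rw [fractSqIntegral_eq, ← integral_const_mul, ← integral_add hi1 hi2]
  refine tendsto_nhds_unique
    (intervalIntegral_tendsto_integral_Ioi 1 (hi1.add hi2) tendsto_id) ?_
  have h : Tendsto (fun T ↦ floorPrimitive s T - floorPrimitive s 1) atTop
      (𝓝 (0 - floorPrimitive s 1)) := (tendsto_floorPrimitive_atTop hs).sub_const _
  have hv : 0 - floorPrimitive s 1 = 1 / (s - 1) - 1 / (2 * s) := by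
    have h1 : 1 - s ≠ 0 := fun h ↦ by simp [← sub_eq_zero.1 h] at hs
    rw [← neg_sub 1 s, one_div_neg_eq_neg_one_div]
    simp [floorPrimitive]
    ring
  rw [hv] at h
  refine h.congr' ?_
  filter_upwards [eventually_ge_atTop 1] with T hT
  refine (intervalIntegral.integral_eq_sub_of_hasDeriv_right_of_le hT
    ((continuousOn_floorPrimitive s).mono fun t ht ↦ zero_lt_one.trans_le ht.1)
    (fun t ht ↦ hasDerivWithinAt_floorPrimitive hs (zero_lt_one.trans ht.1)) ?_).symm
  rw [intervalIntegrable_iff_integrableOn_Ioc_of_le hT]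
  exact (hi1.add hi2).mono_set Set.Ioc_subset_Ioi_self

lemma riemannZeta_eq_mul_integral_floor {s : ℂ} (hs : 1 < s.re) :
    riemannZeta s = s * ∫ t in Set.Ioi (1 : ℝ), (⌊t⌋ : ℂ) * (t : ℂ) ^ (-(s + 1)) := by
  rw [← LSeries_one_eq_riemannZeta hs,
    LSeries_eq_mul_integral 1 zero_le_one hs (LSeriesSummable_one_iff.2 hs)]
  · congr 1
    refine setIntegral_congr_fun measurableSet_Ioi fun t ht ↦ ?_
    have : (⌊t⌋ : ℂ) = (⌊t⌋₊ : ℂ) := by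
      exact_mod_cast congrArg (Int.cast : ℤ → ℂ)
        (Int.natCast_floor_eq_floor (zero_le_one.trans (Set.mem_Ioi.1 ht).le)).symm
    simp [this]
  · exact isBigO_of_le _ fun n ↦ by simp

lemma riemannZeta_eq_of_one_lt_re {s : ℂ} (hs : 1 < s.re) :
    riemannZeta s = (s - 1)⁻¹ + 1 / 2 - s * (s + 1) / 2 * fractSqIntegral s := by
  have h0 : s ≠ 0 := fun h ↦ by norm_num [h] at hs
  have h1 : s - 1 ≠ 0 := fun h ↦ by simp [sub_eq_zero.1 h] at hs
  rw [riemannZeta_eq_mul_integral_floor hs,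
    eq_sub_of_add_eq (integral_floor_add_fractSqIntegral hs)]
  field_simp
  ring

lemma riemannZeta_eq {s : ℂ} (hs : -1 < s.re) (hs1 : s ≠ 1) :
    riemannZeta s = (s - 1)⁻¹ + 1 / 2 - s * (s + 1) / 2 * fractSqIntegral s := by
  have hU : IsOpen {s : ℂ | -1 < s.re} := isOpen_lt continuous_const Complex.continuous_re
  have hg : DifferentiableOn ℂ (fun s ↦ 1 / 2 - s * (s + 1) / 2 * fractSqIntegral s)
      {s | -1 < s.re} :=
    (differentiableOn_const _).sub
      (DifferentiableOn.mul (by fun_prop) differentiableOn_fractSqIntegral)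
  have h := (differentiable_riemannZeta₀.differentiableOn.analyticOnNhd
    hU).eqOn_of_preconnected_of_eventuallyEq (hg.analyticOnNhd hU)
      (convex_halfSpace_re_gt (-1)).isPreconnected (z₀ := 2) (by norm_num) ?_ hs
  · rw [riemannZeta_eq_inv_sub_add hs1, h]
    ring
  · filter_upwards [(isOpen_lt continuous_const Complex.continuous_re).mem_nhds
      (show (1 : ℝ) < (2 : ℂ).re by norm_num)] with z hz
    have hz1 : z ≠ 1 := fun h ↦ by simp [h] at hz
    have := riemannZeta_eq_of_one_lt_re hz
    rw [riemannZeta_eq_inv_sub_add hz1] at this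
    linear_combination this

lemma iteratedDeriv_succ_mul_zero {f : ℂ → ℂ} (hf : AnalyticAt ℂ f 0) (n : ℕ) :
    iteratedDeriv (n + 1) (fun s ↦ s * f s) 0 = (n + 1) * iteratedDeriv n f 0 := by
  rw [iteratedDeriv_fun_mul contDiffAt_fun_id hf.contDiffAt, Finset.sum_eq_single 1]
  · simp [iteratedDeriv_fun_id]
  · intro i _ hi
    rcases i with _ | _ | i <;> simp_all [iteratedDeriv_fun_id]
  · simp

lemma iteratedDeriv_inv_sub_one_zero (n : ℕ) :
    iteratedDeriv n (fun s : ℂ ↦ (s - 1)⁻¹) 0 = -n.factorial := by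
  rw [iteratedDeriv_comp_sub_const (f := Inv.inv), iteratedDeriv_eq_iterate]
  beta_reduce
  rw [iter_deriv_inv, zero_sub, mul_right_comm, ← zpow_natCast, ← zpow_add₀ (by norm_num)]
  simp

lemma analyticAt_fractSqIntegral : AnalyticAt ℂ fractSqIntegral 0 :=
  differentiableOn_fractSqIntegral.analyticAt
    ((isOpen_lt continuous_const Complex.continuous_re).mem_nhds (by simp))

lemma iteratedDeriv_riemannZeta_zero (n : ℕ) : iteratedDeriv n riemannZeta 0 =
    -n.factorial + iteratedDeriv n (fun _ : ℂ ↦ (1 / 2 : ℂ)) 0 -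
      1 / 2 * iteratedDeriv n (fun s ↦ s * (s * fractSqIntegral s + fractSqIntegral s)) 0 := by
  have hF := analyticAt_fractSqIntegral
  have h : riemannZeta =ᶠ[𝓝 0] fun s ↦ ((s - 1)⁻¹ + 1 / 2) -
      1 / 2 * (s * (s * fractSqIntegral s + fractSqIntegral s)) := by
    filter_upwards [(isOpen_lt continuous_const Complex.continuous_re).mem_nhds
      (show (-1 : ℝ) < (0 : ℂ).re by norm_num), isOpen_ne.mem_nhds zero_ne_one] with s hs hs1
    rw [riemannZeta_eq hs hs1]
    ring
  have hinv : AnalyticAt ℂ (fun s : ℂ ↦ (s - 1)⁻¹) 0 :=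
    (analyticAt_id.sub analyticAt_const).inv (by simp)
  have hmul : AnalyticAt ℂ
      (fun s ↦ 1 / 2 * (s * (s * fractSqIntegral s + fractSqIntegral s))) 0 := by
    fun_prop
  rw [h.iteratedDeriv_eq, iteratedDeriv_fun_sub (hinv.fun_add analyticAt_const).contDiffAt
    hmul.contDiffAt, iteratedDeriv_fun_add hinv.contDiffAt (by fun_prop),
    iteratedDeriv_const_mul_field, iteratedDeriv_inv_sub_one_zero]

lemma iteratedDeriv_one_riemannZeta_zero :
    iteratedDeriv 1 riemannZeta 0 = -1 - fractSqIntegral 0 / 2 := by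
  have hF := analyticAt_fractSqIntegral
  rw [iteratedDeriv_riemannZeta_zero, iteratedDeriv_succ_mul_zero (by fun_prop)]
  simp [iteratedDeriv_const]
  ring

lemma iteratedDeriv_add_two_riemannZeta_zero (n : ℕ) :
    iteratedDeriv (n + 2) riemannZeta 0 / (n + 2).factorial =
      -1 - (iteratedDeriv n fractSqIntegral 0 / n.factorial +
        iteratedDeriv (n + 1) fractSqIntegral 0 / (n + 1).factorial) / 2 := by
  have hF := analyticAt_fractSqIntegral
  rw [iteratedDeriv_riemannZeta_zero, iteratedDeriv_succ_mul_zero (by fun_prop),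
    iteratedDeriv_fun_add (AnalyticAt.contDiffAt (by fun_prop)) hF.contDiffAt,
    iteratedDeriv_succ_mul_zero hF]
  have h1 : (n : ℂ) + 1 ≠ 0 := by exact_mod_cast n.succ_ne_zero
  have h2 : (n : ℂ) + 1 + 1 ≠ 0 := by exact_mod_cast (n + 1).succ_ne_zero
  have h3 : (n.factorial : ℂ) ≠ 0 := by exact_mod_cast n.factorial_ne_zero
  simp only [iteratedDeriv_const, Nat.factorial_succ]
  push_cast
  field_simp
  simp
  ring

lemma neg_one_pow_mul_iteratedDeriv_fractSqIntegral_zero (m : ℕ) :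
    (-1) ^ m * iteratedDeriv m fractSqIntegral 0 / (m.factorial : ℂ) =
      (-1 : ℂ) ^ (m + 1) + 2 * ∑ k ∈ Finset.range (m + 2),
        (-1 : ℂ) ^ k * iteratedDeriv k riemannZeta 0 / (Nat.factorial k : ℂ) := by
  induction m with
  | zero =>
    simp [Finset.sum_range_succ, iteratedDeriv_one_riemannZeta_zero, riemannZeta_zero,
      -iteratedDeriv_one]
    ring
  | succ m ih =>
    rw [Finset.sum_range_succ, mul_add, mul_div_assoc _ (iteratedDeriv (m + 1 + 1) _ _),
      iteratedDeriv_add_two_riemannZeta_zero]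
    linear_combination ih

theorem statement8 (m : ℕ) :
    (((1 / (Nat.factorial m : ℝ)) *
        ∫ x in Set.Ioi (1 : ℝ), (Int.fract x ^ 2 - Int.fract x) * Real.log x ^ m / x ^ 2 : ℝ) : ℂ) =
      (-1 : ℂ) ^ (m + 1) +
        2 * ∑ k ∈ Finset.range (m + 2),
          (-1 : ℂ) ^ k * iteratedDeriv k riemannZeta 0 / (Nat.factorial k : ℂ) := by
  rw [← neg_one_pow_mul_iteratedDeriv_fractSqIntegral_zero,
    iteratedDeriv_fractSqIntegral m (by simp), ← mul_assoc, ← mul_pow, neg_zero, zero_sub,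
    mellin_fractSqLogPow_neg_one]
  push_cast
  simp
  ring
end
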